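/- Let A, B, C satisfy condition (ABC) and F(y) = 3Ay² + By + C. Let ψ : ℝ × [-1,1] → ℝ be a smooth function for which there exists M > 0 such that for every a ∈ ℝ the integral over (a,a+1) × (-1,1) of the sum of the squares of all partial derivatives of ψ of order between 1 and 3 is at most M. If ψ satisfies ψ_xxxx + 2ψ_xxyy + ψ_yyyy − [F(y)(ψ_xyy + ψ_xxx) − 6Aψ_x] = 0 in S = ℝ × (-1,1) together with ψ(x,±1) = ψ_x(x,±1) = ψ_y(x,±1) = 0 for all x ∈ ℝ, then ψ is identically zero. -/

import Mathlib

open MeasureTheory intervalIntegral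

/-- Partial derivative in the first (horizontal) variable. -/
noncomputable def pdx (f : ℝ → ℝ → ℝ) : ℝ → ℝ → ℝ := fun x y => deriv (fun t => f t y) x

/-- Partial derivative in the second (vertical) variable. -/
noncomputable def pdy (f : ℝ → ℝ → ℝ) : ℝ → ℝ → ℝ := fun x y => deriv (fun t => f x t) y

open Set

section OneVariable

/-- Cauchy–Schwarz against the constant function. -/
lemma sq_integral_le_mul_integral_sq {f : ℝ → ℝ} {a b : ℝ} (hab : a ≤ b)
    (hf : ContinuousOn f (Icc a b)) :
    (∫ t in a..b, f t) ^ 2 ≤ (b - a) * ∫ t in a..b, f t ^ 2 := by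
  rcases hab.eq_or_lt with rfl | hlt
  · simp
  set m := ∫ t in a..b, f t with hm
  have hfi : IntervalIntegrable f volume a b := hf.intervalIntegrable_of_Icc hab
  have hf2 : IntervalIntegrable (fun t => f t ^ 2) volume a b :=
    (hf.pow 2).intervalIntegrable_of_Icc hab
  have h0 : 0 ≤ ∫ t in a..b, ((b - a) * f t - m) ^ 2 :=
    intervalIntegral.integral_nonneg hab fun t _ => sq_nonneg _
  have h1 : ∫ t in a..b, ((b - a) * f t - m) ^ 2
      = (b - a) ^ 2 * (∫ t in a..b, f t ^ 2) - 2 * (b - a) * m * m + (b - a) * m ^ 2 := by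
    have : ∀ t, ((b - a) * f t - m) ^ 2
        = ((b - a) ^ 2 * f t ^ 2 - 2 * (b - a) * m * f t) + m ^ 2 := fun t => by ring
    simp_rw [this]
    rw [intervalIntegral.integral_add ((hf2.const_mul _).sub (hfi.const_mul _)) (by simp),
      intervalIntegral.integral_sub (hf2.const_mul _) (hfi.const_mul _),
      intervalIntegral.integral_const_mul, intervalIntegral.integral_const_mul,
      intervalIntegral.integral_const]
    simp [hm]
  have hpos : 0 < b - a := sub_pos.2 hlt
  have h2 : 0 ≤ (b - a) * ((b - a) * (∫ t in a..b, f t ^ 2) - m ^ 2) := by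
    rw [h1] at h0; nlinarith
  linarith [nonneg_of_mul_nonneg_right h2 hpos]

lemma sq_sub_le_mul_integral_sq {u u' : ℝ → ℝ} {a b : ℝ} (hab : a ≤ b)
    (hu : ∀ t ∈ Icc a b, HasDerivAt u (u' t) t) (hu' : ContinuousOn u' (Icc a b)) :
    (u b - u a) ^ 2 ≤ (b - a) * ∫ t in a..b, u' t ^ 2 := by
  rw [← intervalIntegral.integral_eq_sub_of_hasDerivAt (f := u) (f' := u')
    (by rwa [uIcc_of_le hab]) (hu'.intervalIntegrable_of_Icc hab)]
  exact sq_integral_le_mul_integral_sq hab hu'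

lemma integral_sq_le_of_subinterval {f : ℝ → ℝ} {a b c d : ℝ} (hca : c ≤ a) (hab : a ≤ b)
    (hbd : b ≤ d) (hf : ContinuousOn f (Icc c d)) :
    ∫ t in a..b, f t ^ 2 ≤ ∫ t in c..d, f t ^ 2 :=
  intervalIntegral.integral_mono_interval hca hab hbd
    (Filter.Eventually.of_forall fun _ => sq_nonneg _)
    ((hf.pow 2).intervalIntegrable_of_Icc (hca.trans (hab.trans hbd)))

lemma sq_le_one_sub_sq_mul_integral {u u' : ℝ → ℝ}
    (hu : ∀ t ∈ Icc (-1 : ℝ) 1, HasDerivAt u (u' t) t) (hu' : ContinuousOn u' (Icc (-1 : ℝ) 1))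
    (hl : u (-1) = 0) (hr : u 1 = 0) {y : ℝ} (hy : y ∈ Icc (-1 : ℝ) 1) :
    u y ^ 2 ≤ (1 - y ^ 2) * ∫ t in (-1 : ℝ)..1, u' t ^ 2 := by
  have hJ : 0 ≤ ∫ t in (-1 : ℝ)..1, u' t ^ 2 :=
    intervalIntegral.integral_nonneg (by norm_num) fun t _ => sq_nonneg _
  obtain ⟨h1, h2⟩ := hy
  rcases le_total 0 y with h0 | h0
  · have hs : Icc y 1 ⊆ Icc (-1) 1 := Icc_subset_Icc_left h1
    have := sq_sub_le_mul_integral_sq h2 (fun t ht => hu t (hs ht)) (hu'.mono hs)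
    have h3 := integral_sq_le_of_subinterval h1 h2 le_rfl hu'
    rw [hr, zero_sub, neg_sq] at this
    calc u y ^ 2 ≤ (1 - y) * ∫ t in y..1, u' t ^ 2 := this
      _ ≤ (1 - y) * ∫ t in (-1 : ℝ)..1, u' t ^ 2 := by gcongr
      _ ≤ _ := mul_le_mul_of_nonneg_right (by nlinarith) hJ
  · have hs : Icc (-1) y ⊆ Icc (-1 : ℝ) 1 := Icc_subset_Icc_right h2
    have := sq_sub_le_mul_integral_sq h1 (fun t ht => hu t (hs ht)) (hu'.mono hs)
    have h3 := integral_sq_le_of_subinterval le_rfl h1 h2 hu'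
    rw [hl, sub_zero] at this
    calc u y ^ 2 ≤ (y - -1) * ∫ t in (-1 : ℝ)..y, u' t ^ 2 := this
      _ ≤ (y - -1) * ∫ t in (-1 : ℝ)..1, u' t ^ 2 := by gcongr
      _ ≤ _ := mul_le_mul_of_nonneg_right (by nlinarith) hJ

lemma sq_le_one_sub_sq_cube_mul_integral {u u' u'' : ℝ → ℝ}
    (hu : ∀ t, HasDerivAt u (u' t) t) (hu' : ∀ t, HasDerivAt u' (u'' t) t)
    (hu'' : Continuous u'')
    (hl : u (-1) = 0) (hr : u 1 = 0) (hl' : u' (-1) = 0) (hr' : u' 1 = 0)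
    {y : ℝ} (hy : y ∈ Icc (-1 : ℝ) 1) :
    u y ^ 2 ≤ (1 - y ^ 2) ^ 3 * ∫ t in (-1 : ℝ)..1, u'' t ^ 2 := by
  have hc : Continuous u' := continuous_iff_continuousAt.2 fun t => (hu' t).continuousAt
  set J := ∫ t in (-1 : ℝ)..1, u'' t ^ 2 with hJdef
  have hJ : 0 ≤ J := intervalIntegral.integral_nonneg (by norm_num) fun t _ => sq_nonneg _
  have key : ∀ t ∈ Icc (-1 : ℝ) 1, u' t ^ 2 ≤ (1 - t ^ 2) * J := fun t ht =>
    sq_le_one_sub_sq_mul_integral (fun t _ => hu' t) hu''.continuousOn hl' hr' ht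
  obtain ⟨h1, h2⟩ := hy
  have hd : 0 ≤ 1 - y ^ 2 := by nlinarith
  have bound : ∀ a b : ℝ, -1 ≤ a → a ≤ b → b ≤ 1 → b - a ≤ 1 - y ^ 2 →
      (∀ t ∈ Icc a b, 1 - t ^ 2 ≤ 1 - y ^ 2) →
      (u b - u a) ^ 2 ≤ (1 - y ^ 2) ^ 3 * J := by
    intro a b ha hab hb hba hm
    have h3 := sq_sub_le_mul_integral_sq hab (fun t _ => hu t) hc.continuousOn
    have h4 : ∫ t in a..b, u' t ^ 2 ≤ ∫ t in a..b, (1 - y ^ 2) * J :=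
      intervalIntegral.integral_mono_on hab ((hc.pow 2).intervalIntegrable _ _) (by simp)
        fun t ht => (key t ⟨ha.trans ht.1, ht.2.trans hb⟩).trans
          (mul_le_mul_of_nonneg_right (hm t ht) hJ)
    rw [intervalIntegral.integral_const, smul_eq_mul] at h4
    have hba' : 0 ≤ b - a := sub_nonneg.2 hab
    calc (u b - u a) ^ 2 ≤ (b - a) * ((b - a) * ((1 - y ^ 2) * J)) :=
          h3.trans (mul_le_mul_of_nonneg_left h4 hba')
      _ ≤ (1 - y ^ 2) * ((1 - y ^ 2) * ((1 - y ^ 2) * J)) := by gcongr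
      _ = _ := by ring
  rcases le_total 0 y with h0 | h0
  · have := bound y 1 h1 h2 le_rfl (by nlinarith) fun t ht => by nlinarith [ht.1]
    simpa [hr] using this
  · have := bound (-1) y le_rfl h1 h2 (by nlinarith) fun t ht => by nlinarith [ht.2]
    simpa [hl] using this

/-- A weighted Poincaré inequality for functions vanishing at both ends, with a weight on the
second derivative that may degenerate linearly at the end points. -/
lemma integral_sq_le_weighted_second_deriv {F g g' g'' : ℝ → ℝ} {c : ℝ} (hc : 0 < c)
    (hF : Continuous F) (hFc : ∀ y ∈ Icc (-1 : ℝ) 1, c * (1 - y ^ 2) ≤ F y)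
    (hg : ∀ y ∈ Icc (-1 : ℝ) 1, HasDerivAt g (g' y) y)
    (hg' : ∀ y ∈ Icc (-1 : ℝ) 1, HasDerivAt g' (g'' y) y)
    (hg'' : ContinuousOn g'' (Icc (-1 : ℝ) 1)) (hl : g (-1) = 0) (hr : g 1 = 0) :
    ∫ y in (-1 : ℝ)..1, g y ^ 2 ≤ 4 / c * ∫ y in (-1 : ℝ)..1, F y * g'' y ^ 2 := by
  have h11 : (-1 : ℝ) ≤ 1 := by norm_num
  have gc : ContinuousOn g (Icc (-1 : ℝ) 1) := HasDerivAt.continuousOn hg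
  have gc' : ContinuousOn g' (Icc (-1 : ℝ) 1) := HasDerivAt.continuousOn hg'
  set J := ∫ y in (-1 : ℝ)..1, g' y ^ 2 with hJdef
  have hJ : 0 ≤ J := intervalIntegral.integral_nonneg h11 fun t _ => sq_nonneg _
  have key : ∀ y ∈ Icc (-1 : ℝ) 1, g y ^ 2 ≤ (1 - y ^ 2) * J := fun y hy =>
    sq_le_one_sub_sq_mul_integral hg gc' hl hr hy
  have iFg : IntervalIntegrable (fun y => F y * g'' y ^ 2) volume (-1) 1 :=
    (hF.continuousOn.mul (hg''.pow 2)).intervalIntegrable_of_Icc h11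
  have igg : IntervalIntegrable (fun y => g y * g'' y) volume (-1) 1 :=
    (gc.mul hg'').intervalIntegrable_of_Icc h11
  have ig' : IntervalIntegrable (fun y => g' y ^ 2) volume (-1) 1 :=
    (gc'.pow 2).intervalIntegrable_of_Icc h11
  have h1 : ∫ y in (-1 : ℝ)..1, g y ^ 2 ≤ ∫ y in (-1 : ℝ)..1, J :=
    intervalIntegral.integral_mono_on h11 ((gc.pow 2).intervalIntegrable_of_Icc h11) (by simp)
      fun y hy => (key y hy).trans (by nlinarith [sq_nonneg y])
  have h2 : ∫ y in (-1 : ℝ)..1, (g' y ^ 2 + g y * g'' y) = 0 := by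
    rw [intervalIntegral.integral_eq_sub_of_hasDerivAt (f := fun y => g y * g' y)]
    · simp [hl, hr]
    · intro y hy
      rw [uIcc_of_le h11] at hy
      exact ((hg y hy).mul (hg' y hy)).congr_deriv (by ring)
    · exact ig'.add igg
  rw [intervalIntegral.integral_add ig' igg] at h2
  have h3 : ∫ y in (-1 : ℝ)..1, -(g y * g'' y)
      ≤ ∫ y in (-1 : ℝ)..1, (J / 4 + 1 / c * (F y * g'' y ^ 2)) := by
    refine intervalIntegral.integral_mono_on h11 igg.neg
      ((by simp : IntervalIntegrable (fun _ => J / 4) volume (-1) 1).add (iFg.const_mul _))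
      fun y hy => ?_
    have hd : 0 ≤ 1 - y ^ 2 := by nlinarith [hy.1, hy.2]
    have hFy := hFc y hy
    have hF0 : 0 ≤ F y := (mul_nonneg hc.le hd).trans hFy
    have e1 : 0 ≤ J / 4 + 1 / c * (F y * g'' y ^ 2) := by positivity
    refine (neg_le_abs _).trans (abs_le_of_sq_le_sq ?_ e1)
    have e2 : g y ^ 2 ≤ F y / c * J := (key y hy).trans (by
      gcongr
      rw [le_div_iff₀ hc]; linarith)
    have e3 : (g y * g'' y) ^ 2 ≤ F y / c * J * g'' y ^ 2 := by
      rw [mul_pow]; gcongr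
    have e4 : F y / c * J * g'' y ^ 2 = 4 * (J / 4) * (1 / c * (F y * g'' y ^ 2)) := by
      field_simp
    nlinarith [sq_nonneg (J / 4 - 1 / c * (F y * g'' y ^ 2))]
  rw [intervalIntegral.integral_add (by simp) (iFg.const_mul _), intervalIntegral.integral_neg,
    intervalIntegral.integral_const_mul, intervalIntegral.integral_const] at h3
  rw [intervalIntegral.integral_const] at h1
  simp only [smul_eq_mul] at h1 h3
  have e5 : 4 / c * ∫ y in (-1 : ℝ)..1, F y * g'' y ^ 2
      = 4 * (1 / c * ∫ y in (-1 : ℝ)..1, F y * g'' y ^ 2) := by ring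
  rw [e5]
  linarith

lemma integral_sq_le_weighted_deriv {F g g' : ℝ → ℝ} {X s : ℝ} (hs : 0 < s) (hX : 0 ≤ X)
    (hF : Continuous F) (hF0 : ∀ y ∈ Icc (-1 : ℝ) 1, 0 ≤ F y)
    (hg : ∀ y ∈ Icc (-1 : ℝ) 1, HasDerivAt g (g' y) y)
    (hg' : ContinuousOn g' (Icc (-1 : ℝ) 1)) (hl : g (-1) = 0) (hr : g 1 = 0)
    (hgX : ∀ y ∈ Icc (-1 : ℝ) 1, g y ^ 2 ≤ F y * X) :
    ∫ y in (-1 : ℝ)..1, g y ^ 2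
      ≤ 2 * s * X + 1 / s * ∫ y in (-1 : ℝ)..1, F y * g' y ^ 2 := by
  have h11 : (-1 : ℝ) ≤ 1 := by norm_num
  have gc : ContinuousOn g (Icc (-1 : ℝ) 1) := HasDerivAt.continuousOn hg
  have iFg : IntervalIntegrable (fun y => F y * g' y ^ 2) volume (-1) 1 :=
    (hF.continuousOn.mul (hg'.pow 2)).intervalIntegrable_of_Icc h11
  have ig : IntervalIntegrable (fun y => g y ^ 2) volume (-1) 1 :=
    (gc.pow 2).intervalIntegrable_of_Icc h11
  have igg : IntervalIntegrable (fun y => 2 * y * (g y * g' y)) volume (-1) 1 :=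
    ((continuous_const.mul continuous_id).continuousOn.mul (gc.mul hg')).intervalIntegrable_of_Icc
      h11
  have h2 : ∫ y in (-1 : ℝ)..1, (g y ^ 2 + 2 * y * (g y * g' y)) = 0 := by
    rw [intervalIntegral.integral_eq_sub_of_hasDerivAt (f := fun y => y * g y ^ 2)]
    · simp [hl, hr]
    · intro y hy
      rw [uIcc_of_le h11] at hy
      exact ((hasDerivAt_id y).mul ((hg y hy).pow 2)).congr_deriv (by simp; ring)
    · exact ig.add igg
  rw [intervalIntegral.integral_add ig igg] at h2
  have h3 : ∫ y in (-1 : ℝ)..1, -(2 * y * (g y * g' y))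
      ≤ ∫ y in (-1 : ℝ)..1, (s * X + 1 / s * (F y * g' y ^ 2)) := by
    refine intervalIntegral.integral_mono_on h11 igg.neg
      ((by simp : IntervalIntegrable (fun _ => s * X) volume (-1) 1).add (iFg.const_mul _))
      fun y hy => ?_
    have hFy := hF0 y hy
    have e1 : 0 ≤ s * X + 1 / s * (F y * g' y ^ 2) := by positivity
    refine (neg_le_abs _).trans (abs_le_of_sq_le_sq ?_ e1)
    have hy2 : y ^ 2 ≤ 1 := by nlinarith [hy.1, hy.2]
    have e3 : (2 * y * (g y * g' y)) ^ 2 ≤ 4 * 1 * ((F y * X) * g' y ^ 2) := by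
      have : (2 * y * (g y * g' y)) ^ 2 = 4 * y ^ 2 * (g y ^ 2 * g' y ^ 2) := by ring
      rw [this]
      gcongr
      exact hgX y hy
    have e4 : 4 * 1 * ((F y * X) * g' y ^ 2) = 4 * (s * X) * (1 / s * (F y * g' y ^ 2)) := by
      field_simp
    nlinarith [sq_nonneg (s * X - 1 / s * (F y * g' y ^ 2))]
  rw [intervalIntegral.integral_add (by simp) (iFg.const_mul _), intervalIntegral.integral_neg,
    intervalIntegral.integral_const, intervalIntegral.integral_const_mul] at h3
  simp only [smul_eq_mul] at h3
  linarith

lemma hasDerivAt_div_profile {F F' u u' : ℝ → ℝ} {y : ℝ} (hF : HasDerivAt F (F' y) y)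
    (hF0 : F y ≠ 0) (hu : HasDerivAt u (u' y) y) :
    HasDerivAt (fun t => u t / F t) (u' y / F y - u y * F' y / F y ^ 2) y :=
  (hu.div hF hF0).congr_deriv (by field_simp)

lemma hasDerivAt_div_profile_deriv {F F' u u' u'' : ℝ → ℝ} {κ y : ℝ}
    (hF : HasDerivAt F (F' y) y) (hF' : HasDerivAt F' κ y)
    (hF0 : F y ≠ 0) (hu : HasDerivAt u (u' y) y) (hu' : HasDerivAt u' (u'' y) y) :
    HasDerivAt (fun t => u' t / F t - u t * F' t / F t ^ 2)
      (u'' y / F y - 2 * u' y * F' y / F y ^ 2 - u y * κ / F y ^ 2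
        + 2 * u y * F' y ^ 2 / F y ^ 3) y :=
  ((hu'.div hF hF0).sub ((hu.mul hF').div (hF.pow 2) (pow_ne_zero 2 hF0))).congr_deriv (by
    simp only [Pi.mul_apply, Pi.pow_apply]
    field_simp
    ring)

/-- Coercivity of the fourth order form `u ↦ ∫ u u⁗ / F` for a concave quadratic profile `F`. -/
lemma integral_sq_div_le_fourth_order {F F' u u₁ u₂ u₃ u₄ : ℝ → ℝ} {c κ : ℝ} (hc : 0 < c)
    (hκ : κ ≤ 0) (hF : ∀ y, HasDerivAt F (F' y) y) (hF' : ∀ y, HasDerivAt F' κ y)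
    (hFpos : ∀ y ∈ Icc (-1 : ℝ) 1, 0 < F y)
    (hFc : ∀ y ∈ Icc (-1 : ℝ) 1, c * (1 - y ^ 2) ≤ F y)
    (h₁ : ∀ y, HasDerivAt u (u₁ y) y) (h₂ : ∀ y, HasDerivAt u₁ (u₂ y) y)
    (h₃ : ∀ y, HasDerivAt u₂ (u₃ y) y) (h₄ : ∀ y, HasDerivAt u₃ (u₄ y) y)
    (hu₄ : Continuous u₄)
    (hl : u (-1) = 0) (hr : u 1 = 0) (hl₁ : u₁ (-1) = 0) (hr₁ : u₁ 1 = 0) :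
    ∫ y in (-1 : ℝ)..1, (u y / F y) ^ 2
      ≤ 4 / c * ∫ y in (-1 : ℝ)..1, u y * u₄ y / F y := by
  have h11 : (-1 : ℝ) ≤ 1 := by norm_num
  have cF : Continuous F := continuous_iff_continuousAt.2 fun t => (hF t).continuousAt
  have cF' : Continuous F' := continuous_iff_continuousAt.2 fun t => (hF' t).continuousAt
  have cu : Continuous u := continuous_iff_continuousAt.2 fun t => (h₁ t).continuousAt
  have cu₁ : Continuous u₁ := continuous_iff_continuousAt.2 fun t => (h₂ t).continuousAt
  have cu₂ : Continuous u₂ := continuous_iff_continuousAt.2 fun t => (h₃ t).continuousAt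
  have ne : ∀ y ∈ Icc (-1 : ℝ) 1, F y ≠ 0 := fun y hy => (hFpos y hy).ne'
  set g : ℝ → ℝ := fun y => u y / F y with hgdef
  set g₁ : ℝ → ℝ := fun y => u₁ y / F y - u y * F' y / F y ^ 2 with hg₁def
  set g₂ : ℝ → ℝ := fun y => u₂ y / F y - 2 * u₁ y * F' y / F y ^ 2 - u y * κ / F y ^ 2
        + 2 * u y * F' y ^ 2 / F y ^ 3 with hg₂def
  have dg : ∀ y ∈ Icc (-1 : ℝ) 1, HasDerivAt g (g₁ y) y := fun y hy =>
    hasDerivAt_div_profile (hF y) (ne y hy) (h₁ y)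
  have dg₁ : ∀ y ∈ Icc (-1 : ℝ) 1, HasDerivAt g₁ (g₂ y) y := fun y hy =>
    hasDerivAt_div_profile_deriv (hF y) (hF' y) (ne y hy) (h₁ y) (h₂ y)
  have cg : ContinuousOn g (Icc (-1 : ℝ) 1) := HasDerivAt.continuousOn dg
  have cg₁ : ContinuousOn g₁ (Icc (-1 : ℝ) 1) := HasDerivAt.continuousOn dg₁
  have cg₂ : ContinuousOn g₂ (Icc (-1 : ℝ) 1) := by
    have ne2 : ∀ y ∈ Icc (-1 : ℝ) 1, F y ^ 2 ≠ 0 := fun y hy => pow_ne_zero 2 (ne y hy)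
    have ne3 : ∀ y ∈ Icc (-1 : ℝ) 1, F y ^ 3 ≠ 0 := fun y hy => pow_ne_zero 3 (ne y hy)
    refine ((ContinuousOn.sub ?_ ?_).sub ?_).add ?_
    · exact cu₂.continuousOn.div cF.continuousOn ne
    · exact ContinuousOn.div (by fun_prop) (by fun_prop) ne2
    · exact ContinuousOn.div (by fun_prop) (by fun_prop) ne2
    · exact ContinuousOn.div (by fun_prop) (by fun_prop) ne3
  have gl : g (-1) = 0 := by simp [hgdef, hl]
  have gr : g 1 = 0 := by simp [hgdef, hr]
  have gl₁ : g₁ (-1) = 0 := by simp [hg₁def, hl, hl₁]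
  have gr₁ : g₁ 1 = 0 := by simp [hg₁def, hr, hr₁]
  have iu : IntervalIntegrable (fun y => u y * u₄ y / F y) volume (-1) 1 :=
    (ContinuousOn.div (by fun_prop) (by fun_prop) ne).intervalIntegrable_of_Icc h11
  have iFg : IntervalIntegrable (fun y => F y * g₂ y ^ 2) volume (-1) 1 :=
    (cF.continuousOn.mul (cg₂.pow 2)).intervalIntegrable_of_Icc h11
  have ig : IntervalIntegrable (fun y => 2 * κ * g₁ y ^ 2) volume (-1) 1 :=
    (continuousOn_const.mul (cg₁.pow 2)).intervalIntegrable_of_Icc h11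
  have hparts : ∫ y in (-1 : ℝ)..1, (u y * u₄ y / F y - (F y * g₂ y ^ 2 - 2 * κ * g₁ y ^ 2))
      = 0 := by
    rw [intervalIntegral.integral_eq_sub_of_hasDerivAt
      (f := fun y => g y * u₃ y - g₁ y * u₂ y + F' y * g₁ y ^ 2 + κ * (g y * g₁ y))]
    · simp [gl, gr, gl₁, gr₁]
    · intro y hy
      rw [uIcc_of_le h11] at hy
      have hne := ne y hy
      refine (((((dg y hy).mul (h₄ y)).sub ((dg₁ y hy).mul (h₃ y))).add
        ((hF' y).mul ((dg₁ y hy).pow 2))).add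
        (((dg y hy).mul (dg₁ y hy)).const_mul κ)).congr_deriv ?_
      have e₂ : u₂ y = F y * g₂ y + 2 * F' y * g₁ y + κ * g y := by
        simp only [hgdef, hg₁def, hg₂def]
        field_simp
        ring
      have e₀ : u y * u₄ y / F y = g y * u₄ y := by
        simp only [hgdef]
        field_simp
      rw [e₀, e₂]
      simp only [Pi.pow_apply]
      push_cast
      ring
    · exact iu.sub (iFg.sub ig)
  rw [intervalIntegral.integral_sub iu (iFg.sub ig), intervalIntegral.integral_sub iFg ig] at hparts
  have hneg : ∫ y in (-1 : ℝ)..1, 2 * κ * g₁ y ^ 2 ≤ 0 := by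
    rw [intervalIntegral.integral_const_mul]
    exact mul_nonpos_of_nonpos_of_nonneg (by linarith)
      (intervalIntegral.integral_nonneg h11 fun y _ => sq_nonneg _)
  refine (integral_sq_le_weighted_second_deriv hc cF hFc dg dg₁ cg₂ gl gr).trans ?_
  have : 0 < 4 / c := by positivity
  gcongr
  linarith

/-- Interpolation: `∫ (u / F)²` is controlled by `-∫ u u'' / F` and `∫ u''²`. -/
lemma integral_sq_div_le_second_order {F F' u u₁ u₂ : ℝ → ℝ} {c κ s : ℝ} (hc : 0 < c)
    (hs : 0 < s)
    (hκ : κ ≤ 0) (hF : ∀ y, HasDerivAt F (F' y) y) (hF' : ∀ y, HasDerivAt F' κ y)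
    (hFpos : ∀ y ∈ Icc (-1 : ℝ) 1, 0 < F y)
    (hFc : ∀ y ∈ Icc (-1 : ℝ) 1, c * (1 - y ^ 2) ≤ F y)
    (h₁ : ∀ y, HasDerivAt u (u₁ y) y) (h₂ : ∀ y, HasDerivAt u₁ (u₂ y) y)
    (hu₂ : Continuous u₂)
    (hl : u (-1) = 0) (hr : u 1 = 0) (hl₁ : u₁ (-1) = 0) (hr₁ : u₁ 1 = 0) :
    0 ≤ ∫ y in (-1 : ℝ)..1, -(u y * u₂ y / F y) ∧
    ∫ y in (-1 : ℝ)..1, (u y / F y) ^ 2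
      ≤ 2 * s * (1 / c ^ 3 * ∫ y in (-1 : ℝ)..1, u₂ y ^ 2)
        + 1 / s * ∫ y in (-1 : ℝ)..1, -(u y * u₂ y / F y) := by
  have h11 : (-1 : ℝ) ≤ 1 := by norm_num
  have cF : Continuous F := continuous_iff_continuousAt.2 fun t => (hF t).continuousAt
  have cF' : Continuous F' := continuous_iff_continuousAt.2 fun t => (hF' t).continuousAt
  have cu : Continuous u := continuous_iff_continuousAt.2 fun t => (h₁ t).continuousAt
  have cu₁ : Continuous u₁ := continuous_iff_continuousAt.2 fun t => (h₂ t).continuousAt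
  have ne : ∀ y ∈ Icc (-1 : ℝ) 1, F y ≠ 0 := fun y hy => (hFpos y hy).ne'
  set g : ℝ → ℝ := fun y => u y / F y with hgdef
  set g₁ : ℝ → ℝ := fun y => u₁ y / F y - u y * F' y / F y ^ 2 with hg₁def
  have dg : ∀ y ∈ Icc (-1 : ℝ) 1, HasDerivAt g (g₁ y) y := fun y hy =>
    hasDerivAt_div_profile (hF y) (ne y hy) (h₁ y)
  have cg : ContinuousOn g (Icc (-1 : ℝ) 1) := HasDerivAt.continuousOn dg
  have cg₁ : ContinuousOn g₁ (Icc (-1 : ℝ) 1) :=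
    (cu₁.continuousOn.div cF.continuousOn ne).sub
      (ContinuousOn.div (by fun_prop) (by fun_prop) fun y hy => pow_ne_zero 2 (ne y hy))
  have gl : g (-1) = 0 := by simp [hgdef, hl]
  have gr : g 1 = 0 := by simp [hgdef, hr]
  have iu : IntervalIntegrable (fun y => -(u y * u₂ y / F y)) volume (-1) 1 :=
    (ContinuousOn.div (by fun_prop) (by fun_prop) ne).neg.intervalIntegrable_of_Icc h11
  have iFg : IntervalIntegrable (fun y => F y * g₁ y ^ 2) volume (-1) 1 :=
    (cF.continuousOn.mul (cg₁.pow 2)).intervalIntegrable_of_Icc h11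
  have ig : IntervalIntegrable (fun y => κ / 2 * g y ^ 2) volume (-1) 1 :=
    (continuousOn_const.mul (cg.pow 2)).intervalIntegrable_of_Icc h11
  have hparts : ∫ y in (-1 : ℝ)..1, (-(u y * u₂ y / F y) - (F y * g₁ y ^ 2 - κ / 2 * g y ^ 2))
      = 0 := by
    rw [intervalIntegral.integral_eq_sub_of_hasDerivAt
      (f := fun y => F' y * g y ^ 2 / 2 - g y * u₁ y)]
    · simp [gl, gr]
    · intro y hy
      rw [uIcc_of_le h11] at hy
      have hne := ne y hy
      refine ((((hF' y).mul ((dg y hy).pow 2)).div_const 2).sub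
        ((dg y hy).mul (h₂ y))).congr_deriv ?_
      have e₁ : u₁ y = F y * g₁ y + F' y * g y := by
        simp only [hgdef, hg₁def]
        field_simp
        ring
      have e₀ : u y * u₂ y / F y = g y * u₂ y := by
        simp only [hgdef]
        field_simp
      rw [e₀, e₁]
      simp only [Pi.pow_apply]
      push_cast
      ring
    · exact iu.sub (iFg.sub ig)
  rw [intervalIntegral.integral_sub iu (iFg.sub ig), intervalIntegral.integral_sub iFg ig] at hparts
  have hneg : ∫ y in (-1 : ℝ)..1, κ / 2 * g y ^ 2 ≤ 0 := by
    rw [intervalIntegral.integral_const_mul]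
    exact mul_nonpos_of_nonpos_of_nonneg (by linarith)
      (intervalIntegral.integral_nonneg h11 fun y _ => sq_nonneg _)
  have hnn : 0 ≤ ∫ y in (-1 : ℝ)..1, F y * g₁ y ^ 2 :=
    intervalIntegral.integral_nonneg h11 fun y hy => mul_nonneg (hFpos y hy).le (sq_nonneg _)
  refine ⟨by linarith, ?_⟩
  set J := ∫ y in (-1 : ℝ)..1, u₂ y ^ 2 with hJdef
  have hJ : 0 ≤ J := intervalIntegral.integral_nonneg h11 fun t _ => sq_nonneg _
  refine (integral_sq_le_weighted_deriv (X := 1 / c ^ 3 * J) hs (by positivity) cF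
    (fun y hy => (hFpos y hy).le) dg cg₁ gl gr fun y hy => ?_).trans ?_
  · have hy3 := sq_le_one_sub_sq_cube_mul_integral h₁ h₂ hu₂ hl hr hl₁ hr₁ hy
    have hFy := hFpos y hy
    have hd : 0 ≤ 1 - y ^ 2 := by nlinarith [hy.1, hy.2]
    have e : (c * (1 - y ^ 2)) ^ 3 ≤ F y ^ 3 := by
      have := hFc y hy
      gcongr
    simp only [hgdef]
    rw [div_pow, div_le_iff₀ (by positivity)]
    have e' : (1 - y ^ 2) ^ 3 ≤ F y ^ 3 / c ^ 3 := by
      rw [le_div_iff₀ (by positivity)]; linarith [mul_pow c (1 - y ^ 2) 3]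
    calc u y ^ 2 ≤ (1 - y ^ 2) ^ 3 * J := hy3
      _ ≤ F y ^ 3 / c ^ 3 * J := by gcongr
      _ = _ := by ring
  · have : 0 < 1 / s := by positivity
    gcongr
    linarith

lemma sq_five_terms_le (a b d e f : ℝ) :
    (a / 2 - b / 2 - 2 * d - e + f) ^ 2 ≤ 20 * (a ^ 2 + b ^ 2 + d ^ 2 + e ^ 2 + f ^ 2) := by
  have h := sq_sum_le_card_mul_sum_sq (s := Finset.univ)
    (f := ![a / 2, -(b / 2), -(2 * d), -e, f])
  simp only [Fin.sum_univ_five, Finset.card_univ, Fintype.card_fin, Matrix.cons_val] at h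
  norm_num at h
  nlinarith [sq_nonneg a, sq_nonneg b, sq_nonneg e, sq_nonneg f]

lemma sq_div_le_of_cube_bound {d c f a J : ℝ} (hc : 0 < c) (hf : 0 < f) (hd : 0 ≤ d) (hd1 : d ≤ 1)
    (hdf : c * d ≤ f) (hJ : 0 ≤ J) (ha : a ^ 2 ≤ d ^ 3 * J) :
    (a / f) ^ 2 ≤ 1 / c ^ 2 * J ∧ a ^ 2 / f ≤ f ^ 2 * (1 / c ^ 3 * J) := by
  have hdf' : d ≤ f / c := by rw [le_div_iff₀ hc]; linarith
  constructor
  · rw [div_pow, div_le_iff₀ (by positivity)]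
    calc a ^ 2 ≤ d ^ 2 * d * J := ha.trans_eq (by ring)
      _ ≤ (f / c) ^ 2 * 1 * J := by gcongr
      _ = _ := by ring
  · rw [div_le_iff₀ hf]
    calc a ^ 2 ≤ d ^ 3 * J := ha
      _ ≤ (f / c) ^ 3 * J := by gcongr
      _ = _ := by ring

lemma abs_mul_le_weighted {a b s : ℝ} (hs : 0 < s) :
    |a * b| ≤ s * (b ^ 2 / 2) + 1 / s * (a ^ 2 / 2) := by
  refine abs_le_of_sq_le_sq ?_ (by positivity)
  have : 4 * (s * (b ^ 2 / 2)) * (1 / s * (a ^ 2 / 2)) = (a * b) ^ 2 := by field_simp; ring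
  nlinarith [sq_nonneg (s * (b ^ 2 / 2) - 1 / s * (a ^ 2 / 2))]

lemma abs_integral_le_of_abs_le {f h : ℝ → ℝ} (hf : ContinuousOn f (Icc (-1 : ℝ) 1))
    (hh : IntervalIntegrable h volume (-1) 1) (hfh : ∀ y ∈ Icc (-1 : ℝ) 1, |f y| ≤ h y) :
    |∫ y in (-1 : ℝ)..1, f y| ≤ ∫ y in (-1 : ℝ)..1, h y :=
  (intervalIntegral.abs_integral_le_integral_abs (by norm_num)).trans
    (intervalIntegral.integral_mono_on (by norm_num)
      (hf.abs.intervalIntegrable_of_Icc (by norm_num)) hh hfh)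

set_option maxHeartbeats 1000000 in
/-- Estimates on a vertical cross-section: the flux and the regularization error are controlled
by the local norm, the flux by interpolation with the dissipation, and the dissipation is
coercive. -/
lemma cross_section_estimates {F F' p₀ q₁ q₂ q₃ q₄ p₁ r₁ r₂ p₂ p₃ S : ℝ → ℝ} {c m κ : ℝ}
    (hc : 0 < c) (hc1 : c ≤ 1) (hm : 1 ≤ m) (hκ : κ ≤ 0) (hκm : κ ^ 2 ≤ m ^ 2)
    (hF : ∀ y, HasDerivAt F (F' y) y) (hF' : ∀ y, HasDerivAt F' κ y)
    (hFpos : ∀ y ∈ Icc (-1 : ℝ) 1, 0 < F y)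
    (hFc : ∀ y ∈ Icc (-1 : ℝ) 1, c * (1 - y ^ 2) ≤ F y)
    (hFm : ∀ y ∈ Icc (-1 : ℝ) 1, F y ≤ m)
    (h₁ : ∀ y, HasDerivAt p₀ (q₁ y) y) (h₂ : ∀ y, HasDerivAt q₁ (q₂ y) y)
    (h₃ : ∀ y, HasDerivAt q₂ (q₃ y) y) (h₄ : ∀ y, HasDerivAt q₃ (q₄ y) y)
    (hq₄ : Continuous q₄)
    (k₁ : ∀ y, HasDerivAt p₁ (r₁ y) y) (k₂ : ∀ y, HasDerivAt r₁ (r₂ y) y)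
    (hr₂ : Continuous r₂) (hp₂ : Continuous p₂) (hp₃ : Continuous p₃) (hSc : Continuous S)
    (hS : ∀ y, p₁ y ^ 2 + q₂ y ^ 2 + p₂ y ^ 2 + r₂ y ^ 2 + p₃ y ^ 2 ≤ S y)
    (hl : p₀ (-1) = 0) (hr : p₀ 1 = 0) (hl₁ : q₁ (-1) = 0) (hr₁ : q₁ 1 = 0)
    (kl : p₁ (-1) = 0) (kr : p₁ 1 = 0) (kl₁ : r₁ (-1) = 0) (kr₁ : r₁ 1 = 0)
    {N Φ D E K : ℝ} (hN : N = ∫ y in (-1 : ℝ)..1, S y) (hK : K = 100 * m ^ 2 * (1 / c) ^ 3)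
    (hΦ : Φ = ∫ y in (-1 : ℝ)..1, ((F y * q₂ y - κ * p₀ y) * p₀ y / 2 - 2 * r₂ y * p₀ y
      - p₃ y * p₀ y + p₂ y * p₁ y + F y * (p₀ y * p₂ y - p₁ y ^ 2 / 2)) / F y)
    (hD : D = ∫ y in (-1 : ℝ)..1, (p₀ y * q₄ y - 2 * (p₁ y * r₂ y) + p₂ y ^ 2) / F y)
    (hE : E = ∫ y in (-1 : ℝ)..1, p₀ y * (r₂ y + p₃ y) / F y) :
    |Φ| ≤ K * N ∧ (∀ s, 0 < s → |Φ| ≤ K * (s * N + 1 / s * D)) ∧ |E| ≤ K * N ∧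
      ∫ y in (-1 : ℝ)..1, p₀ y ^ 2 ≤ K * D := by
  have h11 : (-1 : ℝ) ≤ 1 := by norm_num
  have cF : Continuous F := continuous_iff_continuousAt.2 fun t => (hF t).continuousAt
  have cp₀ : Continuous p₀ := continuous_iff_continuousAt.2 fun t => (h₁ t).continuousAt
  have cq₂ : Continuous q₂ := continuous_iff_continuousAt.2 fun t => (h₃ t).continuousAt
  have cp₁ : Continuous p₁ := continuous_iff_continuousAt.2 fun t => (k₁ t).continuousAt
  have ne : ∀ y ∈ Icc (-1 : ℝ) 1, F y ≠ 0 := fun y hy => (hFpos y hy).ne'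
  set ρ := 1 / c with hρ
  have hρ1 : 1 ≤ ρ := by rw [hρ, le_div_iff₀ hc]; linarith
  have hm2 : 1 ≤ m ^ 2 := one_le_pow₀ hm
  have hρ2 : ρ ^ 2 ≤ ρ ^ 3 := pow_le_pow_right₀ hρ1 (by norm_num)
  have hρ3 : ρ ≤ ρ ^ 3 := le_self_pow₀ hρ1 (by norm_num)
  have hρ31 : 1 ≤ ρ ^ 3 := one_le_pow₀ hρ1
  set Q := m ^ 2 * ρ ^ 3 with hQ
  have hQm : m ^ 2 ≤ Q := le_mul_of_one_le_right (by positivity) hρ31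
  have hQρ : ρ ^ 3 ≤ Q := le_mul_of_one_le_left (by positivity) hm2
  have hQ1 : 1 ≤ Q := hm2.trans hQm
  have hQmρ : m ^ 2 * ρ ≤ Q := by rw [hQ]; gcongr
  have hKQ : K = 100 * Q := by rw [hK, hQ]; ring
  have iS : IntervalIntegrable S volume (-1) 1 := hSc.intervalIntegrable _ _
  have icst : ∀ a : ℝ, IntervalIntegrable (fun _ => a) volume (-1) 1 := fun a => by simp
  have hS0 : ∀ y, 0 ≤ S y := fun y => (by positivity : (0 : ℝ) ≤ _).trans (hS y)
  have hN0 : 0 ≤ N := hN ▸ intervalIntegral.integral_nonneg h11 fun y _ => hS0 y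
  have hJq : ∫ y in (-1 : ℝ)..1, q₂ y ^ 2 ≤ N := hN ▸
    intervalIntegral.integral_mono_on h11 ((cq₂.pow 2).intervalIntegrable _ _) iS
      fun y _ => by
        linarith [hS y, sq_nonneg (p₁ y), sq_nonneg (p₂ y), sq_nonneg (r₂ y), sq_nonneg (p₃ y)]
  have hJr : ∫ y in (-1 : ℝ)..1, r₂ y ^ 2 ≤ N := hN ▸
    intervalIntegral.integral_mono_on h11 ((hr₂.pow 2).intervalIntegrable _ _) iS
      fun y _ => by
        linarith [hS y, sq_nonneg (p₁ y), sq_nonneg (p₂ y), sq_nonneg (q₂ y), sq_nonneg (p₃ y)]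
  have dpos : ∀ y ∈ Icc (-1 : ℝ) 1, 0 ≤ 1 - y ^ 2 := fun y hy => by nlinarith [hy.1, hy.2]
  have dle : ∀ y : ℝ, 1 - y ^ 2 ≤ 1 := fun y => by nlinarith [sq_nonneg y]
  have p₀cube : ∀ y ∈ Icc (-1 : ℝ) 1, p₀ y ^ 2 ≤ (1 - y ^ 2) ^ 3 * N := fun y hy =>
    (sq_le_one_sub_sq_cube_mul_integral h₁ h₂ cq₂ hl hr hl₁ hr₁ hy).trans
      (mul_le_mul_of_nonneg_left hJq (pow_nonneg (dpos y hy) 3))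
  have p₁cube : ∀ y ∈ Icc (-1 : ℝ) 1, p₁ y ^ 2 ≤ (1 - y ^ 2) ^ 3 * N := fun y hy =>
    (sq_le_one_sub_sq_cube_mul_integral k₁ k₂ hr₂ kl kr kl₁ kr₁ hy).trans
      (mul_le_mul_of_nonneg_left hJr (pow_nonneg (dpos y hy) 3))
  have p₀N : ∀ y ∈ Icc (-1 : ℝ) 1, p₀ y ^ 2 ≤ N := fun y hy => (p₀cube y hy).trans
    (mul_le_of_le_one_left hN0 (pow_le_one₀ (dpos y hy) (dle y)))
  have eρ2 : 1 / c ^ 2 = ρ ^ 2 := by rw [hρ]; ring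
  have eρ3 : 1 / c ^ 3 = ρ ^ 3 := by rw [hρ]; ring
  have g₀N : ∀ y ∈ Icc (-1 : ℝ) 1, (p₀ y / F y) ^ 2 ≤ Q * N := fun y hy => by
    have := (sq_div_le_of_cube_bound hc (hFpos y hy) (dpos y hy) (dle y) (hFc y hy) hN0
      (p₀cube y hy)).1
    rw [eρ2] at this
    exact this.trans (by gcongr; linarith)
  have g₁N : ∀ y ∈ Icc (-1 : ℝ) 1, (p₁ y / F y) ^ 2 ≤ Q * N := fun y hy => by
    have := (sq_div_le_of_cube_bound hc (hFpos y hy) (dpos y hy) (dle y) (hFc y hy) hN0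
      (p₁cube y hy)).1
    rw [eρ2] at this
    exact this.trans (by gcongr; linarith)
  have p₁F : ∀ y ∈ Icc (-1 : ℝ) 1, p₁ y ^ 2 / F y ≤ Q * N := fun y hy => by
    have := (sq_div_le_of_cube_bound hc (hFpos y hy) (dpos y hy) (dle y) (hFc y hy) hN0
      (p₁cube y hy)).2
    have hf := hFpos y hy
    have hfm := hFm y hy
    rw [eρ3] at this
    calc p₁ y ^ 2 / F y ≤ F y ^ 2 * (ρ ^ 3 * N) := this
      _ ≤ m ^ 2 * (ρ ^ 3 * N) := by gcongr
      _ = Q * N := by rw [hQ]; ring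
  set X : ℝ → ℝ := fun y => (F y * q₂ y - κ * p₀ y) / 2 - 2 * r₂ y - p₃ y + F y * p₂ y with hX
  have XS : ∀ y ∈ Icc (-1 : ℝ) 1, X y ^ 2 ≤ 20 * Q * (S y + N) := fun y hy => by
    have hf := hFpos y hy
    have hfm : F y ^ 2 ≤ m ^ 2 := by have := hFm y hy; gcongr
    have e1 : (F y * q₂ y) ^ 2 ≤ m ^ 2 * q₂ y ^ 2 := by rw [mul_pow]; gcongr
    have e2 : (κ * p₀ y) ^ 2 ≤ m ^ 2 * p₀ y ^ 2 := by rw [mul_pow]; gcongr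
    have e3 : (F y * p₂ y) ^ 2 ≤ m ^ 2 * p₂ y ^ 2 := by rw [mul_pow]; gcongr
    have e4 : r₂ y ^ 2 ≤ m ^ 2 * r₂ y ^ 2 := le_mul_of_one_le_left (sq_nonneg _) hm2
    have e5 : p₃ y ^ 2 ≤ m ^ 2 * p₃ y ^ 2 := le_mul_of_one_le_left (sq_nonneg _) hm2
    have h5 := sq_five_terms_le (F y * q₂ y) (κ * p₀ y) (r₂ y) (p₃ y) (F y * p₂ y)
    have e6 : X y = F y * q₂ y / 2 - κ * p₀ y / 2 - 2 * r₂ y - p₃ y + F y * p₂ y := by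
      simp only [hX]; ring
    rw [e6]
    calc _ ≤ _ := h5
      _ ≤ 20 * (m ^ 2 * q₂ y ^ 2 + m ^ 2 * p₀ y ^ 2 + m ^ 2 * r₂ y ^ 2 + m ^ 2 * p₃ y ^ 2
          + m ^ 2 * p₂ y ^ 2) := by linarith
      _ = 20 * m ^ 2 * (q₂ y ^ 2 + p₀ y ^ 2 + r₂ y ^ 2 + p₃ y ^ 2 + p₂ y ^ 2) := by ring
      _ ≤ 20 * m ^ 2 * (S y + N) :=
        mul_le_mul_of_nonneg_left (by linarith [hS y, p₀N y hy, sq_nonneg (p₁ y)])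
          (by positivity)
      _ ≤ _ := by
        have := add_nonneg (hS0 y) hN0
        gcongr
  have split : ∀ y ∈ Icc (-1 : ℝ) 1, ((F y * q₂ y - κ * p₀ y) * p₀ y / 2 - 2 * r₂ y * p₀ y
      - p₃ y * p₀ y + p₂ y * p₁ y + F y * (p₀ y * p₂ y - p₁ y ^ 2 / 2)) / F y
      = p₀ y / F y * X y + p₁ y / F y * p₂ y - p₁ y ^ 2 / 2 := fun y hy => by
    have := ne y hy
    simp only [hX]
    field_simp
    ring
  have cG : ContinuousOn (fun y => ((F y * q₂ y - κ * p₀ y) * p₀ y / 2 - 2 * r₂ y * p₀ y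
      - p₃ y * p₀ y + p₂ y * p₁ y + F y * (p₀ y * p₂ y - p₁ y ^ 2 / 2)) / F y)
      (Icc (-1 : ℝ) 1) := ContinuousOn.div (by fun_prop) (by fun_prop) ne
  have iSN : ∀ a : ℝ, IntervalIntegrable (fun y => a * (S y + N)) volume (-1) 1 := fun a =>
    (iS.add (icst N)).const_mul a
  have intSN : ∀ a : ℝ, ∫ y in (-1 : ℝ)..1, a * (S y + N) = a * (3 * N) := fun a => by
    rw [intervalIntegral.integral_const_mul, intervalIntegral.integral_add iS (icst N),
      intervalIntegral.integral_const, ← hN]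
    simp only [smul_eq_mul]
    ring
  have young : ∀ a b : ℝ, |a * b| ≤ b ^ 2 / 2 + a ^ 2 / 2 := fun a b => by
    simpa using abs_mul_le_weighted (a := a) (b := b) one_pos
  have abs3 : ∀ a b d : ℝ, |a + b - d| ≤ |a| + |b| + |d| := fun a b d =>
    (abs_sub _ _).trans (by gcongr; exact abs_add_le _ _)
  -- the three parts of the dissipation
  have i₀ : IntervalIntegrable (fun y => p₀ y * q₄ y / F y) volume (-1) 1 :=
    (ContinuousOn.div (by fun_prop) (by fun_prop) ne).intervalIntegrable_of_Icc h11
  have i₁ : IntervalIntegrable (fun y => -(p₁ y * r₂ y / F y)) volume (-1) 1 :=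
    (ContinuousOn.div (by fun_prop) (by fun_prop) ne).neg.intervalIntegrable_of_Icc h11
  have i₂ : IntervalIntegrable (fun y => p₂ y ^ 2 / F y) volume (-1) 1 :=
    (ContinuousOn.div (by fun_prop) (by fun_prop) ne).intervalIntegrable_of_Icc h11
  have ig₀ : IntervalIntegrable (fun y => (p₀ y / F y) ^ 2) volume (-1) 1 :=
    ((ContinuousOn.div (by fun_prop) (by fun_prop) ne).pow 2).intervalIntegrable_of_Icc h11
  have ig₁ : IntervalIntegrable (fun y => (p₁ y / F y) ^ 2) volume (-1) 1 :=
    ((ContinuousOn.div (by fun_prop) (by fun_prop) ne).pow 2).intervalIntegrable_of_Icc h11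
  set D₀ := ∫ y in (-1 : ℝ)..1, p₀ y * q₄ y / F y with hD₀
  set D₁ := ∫ y in (-1 : ℝ)..1, -(p₁ y * r₂ y / F y) with hD₁
  set D₂ := ∫ y in (-1 : ℝ)..1, p₂ y ^ 2 / F y with hD₂
  have hDsum : D = D₀ + 2 * D₁ + D₂ := by
    rw [hD, hD₀, hD₁, hD₂, ← intervalIntegral.integral_const_mul,
      ← intervalIntegral.integral_add i₀ (i₁.const_mul 2),
      ← intervalIntegral.integral_add (i₀.add (i₁.const_mul 2)) i₂]
    congr 1
    ext y
    ring
  have c₀ := integral_sq_div_le_fourth_order hc hκ hF hF' hFpos hFc h₁ h₂ h₃ h₄ hq₄ hl hr hl₁ hr₁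
  have c₁ := fun s (hs : 0 < s) =>
    integral_sq_div_le_second_order hc hs hκ hF hF' hFpos hFc k₁ k₂ hr₂ kl kr kl₁ kr₁
  rw [← hD₀, show 4 / c = 4 * ρ by rw [hρ]; ring] at c₀
  have hD₁0 : 0 ≤ D₁ := (c₁ 1 one_pos).1
  have hD₂0 : 0 ≤ D₂ := intervalIntegral.integral_nonneg h11 fun y hy =>
    div_nonneg (sq_nonneg _) (hFpos y hy).le
  have hg₀0 : 0 ≤ ∫ y in (-1 : ℝ)..1, (p₀ y / F y) ^ 2 :=
    intervalIntegral.integral_nonneg h11 fun y _ => sq_nonneg _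
  have hD₀0 : 0 ≤ D₀ := nonneg_of_mul_nonneg_right (hg₀0.trans c₀) (by positivity)
  refine ⟨?_, fun s hs => ?_, ?_, ?_⟩
  · rw [hΦ]
    refine (abs_integral_le_of_abs_le cG (iSN (13 * Q)) fun y hy => ?_).trans ?_
    · rw [split y hy]
      have := abs3 (p₀ y / F y * X y) (p₁ y / F y * p₂ y) (p₁ y ^ 2 / 2)
      have y1 := young (p₀ y / F y) (X y)
      have y2 := young (p₁ y / F y) (p₂ y)
      have y3 : |p₁ y ^ 2 / 2| = p₁ y ^ 2 / 2 := abs_of_nonneg (by positivity)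
      have y4 : S y ≤ Q * S y := le_mul_of_one_le_left (hS0 y) hQ1
      have y5 : 0 ≤ Q * N := by positivity
      linarith [hS y, g₀N y hy, g₁N y hy, XS y hy, sq_nonneg (q₂ y), sq_nonneg (r₂ y),
        sq_nonneg (p₃ y), hS0 y]
    · rw [intSN, hKQ]
      have y5 : 0 ≤ Q * N := by positivity
      linarith
  · rw [hΦ]
    refine (abs_integral_le_of_abs_le cG (h := fun y => (s * (11 * Q)) * (S y + N)
      + (1 / s / 2 * (p₀ y / F y) ^ 2 + 1 / s / 2 * (p₂ y ^ 2 / F y))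
      + m ^ 2 / 2 * (p₁ y / F y) ^ 2)
      (((iSN _).add ((ig₀.const_mul _).add (i₂.const_mul _))).add (ig₁.const_mul _))
      fun y hy => ?_).trans ?_
    · rw [split y hy]
      have hf := hFpos y hy
      have hfm : F y ^ 2 ≤ m ^ 2 := by have := hFm y hy; gcongr
      have := abs3 (p₀ y / F y * X y) (p₁ y / F y * p₂ y) (p₁ y ^ 2 / 2)
      have y1 := abs_mul_le_weighted (a := p₀ y / F y) (b := X y) hs
      have y2 : |p₁ y / F y * p₂ y| ≤ s * (Q * N / 2) + 1 / s * (p₂ y ^ 2 / F y / 2) := by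
        have z := abs_mul_le_weighted (a := p₂ y / √(F y)) (b := p₁ y / √(F y)) hs
        rw [div_pow, div_pow, Real.sq_sqrt hf.le] at z
        have z' : p₂ y / √(F y) * (p₁ y / √(F y)) = p₁ y / F y * p₂ y := by
          rw [div_mul_div_comm, Real.mul_self_sqrt hf.le]; ring
        rw [z'] at z
        refine z.trans ?_
        have := p₁F y hy
        gcongr
      have y3 : |p₁ y ^ 2 / 2| ≤ m ^ 2 / 2 * (p₁ y / F y) ^ 2 := by
        rw [abs_of_nonneg (by positivity)]
        have : p₁ y ^ 2 / 2 = F y ^ 2 / 2 * (p₁ y / F y) ^ 2 := by field_simp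
        rw [this]
        gcongr
      have y4 : s * (X y ^ 2 / 2) ≤ s * (10 * Q * (S y + N)) := by
        have := XS y hy
        gcongr
        linarith
      have y5 : 0 ≤ s * (Q * N) := by positivity
      have y6 : 0 ≤ s * (Q * S y) := by have := hS0 y; positivity
      linarith
    · rw [intervalIntegral.integral_add ((iSN _).add ((ig₀.const_mul _).add (i₂.const_mul _)))
          (ig₁.const_mul _), intervalIntegral.integral_add (iSN _)
          ((ig₀.const_mul _).add (i₂.const_mul _)),
        intervalIntegral.integral_add (ig₀.const_mul _) (i₂.const_mul _), intSN,
        intervalIntegral.integral_const_mul, intervalIntegral.integral_const_mul,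
        intervalIntegral.integral_const_mul, ← hD₂, hKQ, hDsum]
      have z₁ := (c₁ s hs).2
      rw [← hD₁, eρ3] at z₁
      have hs' : 0 < 1 / s := by positivity
      set t := 1 / s with ht
      have w₀ : t / 2 * ∫ y in (-1 : ℝ)..1, (p₀ y / F y) ^ 2 ≤ t / 2 * (4 * Q * D₀) := by
        refine mul_le_mul_of_nonneg_left (c₀.trans ?_) (by positivity)
        gcongr
        linarith
      have w₁ : m ^ 2 / 2 * ∫ y in (-1 : ℝ)..1, (p₁ y / F y) ^ 2
          ≤ m ^ 2 / 2 * (2 * s * (ρ ^ 3 * N) + t * D₁) := by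
        refine mul_le_mul_of_nonneg_left (z₁.trans ?_) (by positivity)
        gcongr
      have w₂ : m ^ 2 / 2 * (2 * s * (ρ ^ 3 * N) + t * D₁) ≤ s * (Q * N) + t * (Q * D₁) := by
        have : m ^ 2 * (t * D₁) ≤ Q * (t * D₁) := by gcongr
        have h' : 0 ≤ Q * (t * D₁) := by positivity
        have : m ^ 2 / 2 * (2 * s * (ρ ^ 3 * N)) = s * (Q * N) := by rw [hQ]; ring
        linarith
      have w₃ : t * D₂ ≤ Q * (t * D₂) := le_mul_of_one_le_left (by positivity) hQ1
      have v₀ : 0 ≤ Q * (t * D₀) := by positivity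
      have v₁ : 0 ≤ Q * (t * D₁) := by positivity
      have v₂ : 0 ≤ Q * (t * D₂) := by positivity
      have v₃ : 0 ≤ s * (Q * N) := by positivity
      linarith
  · rw [hE]
    refine (abs_integral_le_of_abs_le (f := fun y => p₀ y * (r₂ y + p₃ y) / F y)
      (ContinuousOn.div (by fun_prop) (by fun_prop) ne) (iSN (2 * Q)) fun y hy => ?_).trans ?_
    · have : p₀ y * (r₂ y + p₃ y) / F y = p₀ y / F y * (r₂ y + p₃ y) := by ring
      rw [this]
      have y1 := young (p₀ y / F y) (r₂ y + p₃ y)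
      have y4 : S y ≤ Q * S y := le_mul_of_one_le_left (hS0 y) hQ1
      have y5 : 0 ≤ Q * N := by positivity
      have y6 : (r₂ y + p₃ y) ^ 2 ≤ 2 * r₂ y ^ 2 + 2 * p₃ y ^ 2 := by
        nlinarith [sq_nonneg (r₂ y - p₃ y)]
      linarith [hS y, g₀N y hy, sq_nonneg (q₂ y), sq_nonneg (p₁ y), sq_nonneg (p₂ y), hS0 y]
    · rw [intSN, hKQ]
      have y5 : 0 ≤ Q * N := by positivity
      linarith
  · have z : ∫ y in (-1 : ℝ)..1, p₀ y ^ 2 ≤ ∫ y in (-1 : ℝ)..1, m ^ 2 * (p₀ y / F y) ^ 2 := by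
      refine intervalIntegral.integral_mono_on h11 ((cp₀.pow 2).intervalIntegrable _ _)
        (ig₀.const_mul _) fun y hy => ?_
      have hf := hFpos y hy
      have hfm : F y ^ 2 ≤ m ^ 2 := by have := hFm y hy; gcongr
      have : p₀ y ^ 2 = F y ^ 2 * (p₀ y / F y) ^ 2 := by field_simp
      rw [this]
      gcongr
    rw [intervalIntegral.integral_const_mul] at z
    have z' : m ^ 2 * ∫ y in (-1 : ℝ)..1, (p₀ y / F y) ^ 2 ≤ m ^ 2 * (4 * ρ * D₀) := by gcongr
    have z₂ : m ^ 2 * (4 * ρ * D₀) ≤ 4 * Q * D₀ := by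
      have := mul_le_mul_of_nonneg_right hQmρ hD₀0
      linarith
    rw [hKQ, hDsum]
    have v₀ : 0 ≤ Q * D₀ := by positivity
    have v₁ : 0 ≤ Q * D₁ := by positivity
    have v₂ : 0 ≤ Q * D₂ := by positivity
    linarith

end OneVariable

section Growth

lemma exists_le_integral_unit_slice {f R : ℝ → ℝ} (hf : Continuous f) (hR : Continuous R)
    (hfR : ∀ x, f x ≤ R x) (c : ℝ) :
    ∃ b ∈ Icc c (c + 1), f b ≤ ∫ x in c..(c + 1), R x := by
  obtain ⟨b, hb, hmin⟩ := isCompact_Icc.exists_isMinOn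
    (nonempty_Icc.2 (by linarith : c ≤ c + 1)) hf.continuousOn
  refine ⟨b, hb, ?_⟩
  have h : ∫ _ in c..(c + 1), f b ≤ ∫ x in c..(c + 1), R x :=
    intervalIntegral.integral_mono_on (by linarith) (by simp) (hR.intervalIntegrable _ _)
      fun x hx => (hmin hx).trans (hfR x)
  simpa using h

lemma integral_le_nat_mul_of_unit_slices {N : ℝ → ℝ} {M : ℝ} (hN : Continuous N)
    (hM : ∀ a, ∫ x in a..(a + 1), N x ≤ M) (a : ℝ) (k : ℕ) :
    ∫ x in a..(a + k), N x ≤ k * M := by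
  induction k with
  | zero => simp
  | succ k ih =>
    have h := hM (a + k)
    rw [add_assoc] at h
    push_cast
    rw [← intervalIntegral.integral_add_adjacent_intervals (hN.intervalIntegrable a (a + k))
      (hN.intervalIntegrable _ _)]
    linarith

/-- The dissipation in a bounded slab is controlled by the flux through the two adjacent unit
slices. -/
lemma dissipation_le_flux {Φ D E N R : ℝ → ℝ} {K M ε : ℝ} (hε : 0 ≤ ε) (hK : 0 ≤ K)
    (hN : Continuous N) (hN0 : ∀ x, 0 ≤ N x) (hM : ∀ a, ∫ x in a..(a + 1), N x ≤ M)
    (hD : Continuous D) (hD0 : ∀ x, 0 ≤ D x) (hE : Continuous E)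
    (hΦ : ∀ x, HasDerivAt Φ (D x + ε * E x) x) (hEN : ∀ x, |E x| ≤ K * N x)
    (hR : Continuous R) (hΦR : ∀ x, |Φ x| ≤ R x) (x₀ : ℝ) (n : ℕ) :
    ∫ x in (x₀ - n)..(x₀ + n), D x ≤ (∫ x in (x₀ + n)..(x₀ + n + 1), R x)
      + (∫ x in (x₀ - n - 1)..(x₀ - n), R x) + ε * (K * M * (2 * n + 2)) := by
  have hΦc : Continuous Φ := continuous_iff_continuousAt.2 fun t => (hΦ t).continuousAt
  obtain ⟨b, hb, hb'⟩ := exists_le_integral_unit_slice hΦc.abs hR hΦR (x₀ + n)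
  obtain ⟨a, ha, ha'⟩ := exists_le_integral_unit_slice hΦc.abs hR hΦR (x₀ - n - 1)
  rw [sub_add_cancel] at ha ha'
  have hn : (0 : ℝ) ≤ n := n.cast_nonneg
  have hab : a ≤ b := by linarith [ha.2, hb.1]
  have h1 : ∫ x in (x₀ - n)..(x₀ + n), D x ≤ ∫ x in a..b, D x :=
    intervalIntegral.integral_mono_interval ha.2 (by linarith) hb.1
      (Filter.Eventually.of_forall hD0) (hD.intervalIntegrable _ _)
  have h2 : ∫ x in a..b, (D x + ε * E x) = Φ b - Φ a :=
    intervalIntegral.integral_eq_sub_of_hasDerivAt (fun x _ => hΦ x)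
      ((hD.add (hE.const_mul ε)).intervalIntegrable _ _)
  rw [intervalIntegral.integral_add (hD.intervalIntegrable _ _)
    ((hE.const_mul ε).intervalIntegrable _ _), intervalIntegral.integral_const_mul] at h2
  have h3 : ∫ x in a..b, -E x ≤ ∫ x in a..b, K * N x :=
    intervalIntegral.integral_mono_on hab (hE.neg.intervalIntegrable _ _)
      ((hN.const_mul K).intervalIntegrable _ _) fun x _ => (neg_le_abs _).trans (hEN x)
  rw [intervalIntegral.integral_neg, intervalIntegral.integral_const_mul] at h3
  have h4 : ∫ x in a..b, N x ≤ ∫ x in (x₀ - n - 1)..(x₀ + n + 1), N x :=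
    intervalIntegral.integral_mono_interval ha.1 hab hb.2
      (Filter.Eventually.of_forall hN0) (hN.intervalIntegrable _ _)
  have h5 := integral_le_nat_mul_of_unit_slices hN hM (x₀ - n - 1) (2 * n + 2)
  rw [show x₀ - n - 1 + ((2 * n + 2 : ℕ) : ℝ) = x₀ + n + 1 by push_cast; ring] at h5
  push_cast at h5
  have h6 : -∫ x in a..b, E x ≤ K * M * (2 * n + 2) :=
    h3.trans ((mul_le_mul_of_nonneg_left (h4.trans h5) hK).trans_eq (by ring))
  have h7 := mul_le_mul_of_nonneg_left h6 hε
  linarith [le_abs_self (Φ b), neg_abs_le (Φ a)]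

/-- Saint-Venant type uniqueness principle: if the flux is dominated by the (uniformly locally
integrable) norm and, by interpolation, by the dissipation, then everything controlled by the
dissipation vanishes. -/
lemma eq_zero_of_flux_bounds {N q : ℝ → ℝ} {K M : ℝ} (hK : 0 < K) (hM0 : 0 ≤ M)
    (hN : Continuous N) (hN0 : ∀ x, 0 ≤ N x) (hM : ∀ a, ∫ x in a..(a + 1), N x ≤ M)
    (hq : Continuous q) (hq0 : ∀ x, 0 ≤ q x)
    (H : ∀ ε : ℝ, 0 < ε → ε ≤ 1 → ∃ Φ D E : ℝ → ℝ, Continuous D ∧ Continuous E ∧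
      (∀ x, HasDerivAt Φ (D x + ε * E x) x) ∧ (∀ x, |Φ x| ≤ K * N x) ∧
      (∀ x s, 0 < s → |Φ x| ≤ K * (s * N x + 1 / s * D x)) ∧
      (∀ x, |E x| ≤ K * N x) ∧ ∀ x, q x ≤ K * D x) (x₀ : ℝ) : q x₀ = 0 := by
  have key : ∀ k : ℕ, 1 ≤ k → (k : ℝ) * ∫ x in (x₀ - 1)..(x₀ + 1), q x
      ≤ K * (6 * (K * M) + 8 * (K * (K * M))) := by
    intro k hk
    have hk1 : (1 : ℝ) ≤ k := by exact_mod_cast hk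
    have hk0 : (0 : ℝ) < k := by linarith
    obtain ⟨Φ, D, E, hD, hE, hΦ, hΦN, hΦD, hEN, hqD⟩ :=
      H (1 / (k : ℝ) ^ 4) (by positivity) (by
        rw [div_le_one (by positivity)]; exact one_le_pow₀ hk1)
    set ε := 1 / (k : ℝ) ^ 4 with hεdef
    have hε : 0 < ε := by positivity
    have hD0 : ∀ x, 0 ≤ D x := fun x =>
      nonneg_of_mul_nonneg_right ((hq0 x).trans (hqD x)) hK
    set a : ℕ → ℝ := fun n => ∫ x in (x₀ - n)..(x₀ + n), D x with ha
    have ha0 : ∀ n, 0 ≤ a n := fun n =>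
      intervalIntegral.integral_nonneg (by linarith [n.cast_nonneg (α := ℝ)]) fun x _ => hD0 x
    have hNi : ∀ c d : ℝ, IntervalIntegrable N volume c d := hN.intervalIntegrable
    have hDi : ∀ c d : ℝ, IntervalIntegrable D volume c d := hD.intervalIntegrable
    have hMl : ∀ c, ∫ x in (c - 1)..c, N x ≤ M := fun c => by simpa using hM (c - 1)
    have succ_eq : ∀ n : ℕ, a (n + 1) - a n = (∫ x in (x₀ + n)..(x₀ + n + 1), D x)
        + ∫ x in (x₀ - n - 1)..(x₀ - n), D x := fun n => by
      have e1 := intervalIntegral.integral_add_adjacent_intervals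
        (hDi (x₀ - n - 1) (x₀ - n)) (hDi (x₀ - n) (x₀ + n))
      have e2 := intervalIntegral.integral_add_adjacent_intervals
        (hDi (x₀ - n - 1) (x₀ + n)) (hDi (x₀ + n) (x₀ + n + 1))
      have e3 : a (n + 1) = ∫ x in (x₀ - n - 1)..(x₀ + n + 1), D x := by
        simp only [ha]
        push_cast
        rw [← sub_sub, ← add_assoc]
      rw [e3]
      simp only [ha]
      linarith
    have mono : Monotone a := monotone_nat_of_le_succ fun n => by
      have := succ_eq n
      have i1 : 0 ≤ ∫ x in (x₀ + n)..(x₀ + n + 1), D x :=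
        intervalIntegral.integral_nonneg (by linarith) fun x _ => hD0 x
      have i2 : 0 ≤ ∫ x in (x₀ - n - 1)..(x₀ - n), D x :=
        intervalIntegral.integral_nonneg (by linarith) fun x _ => hD0 x
      linarith
    have bdd : ∀ n : ℕ, a n ≤ 2 * (K * M) + ε * (K * M * (2 * n + 2)) := fun n => by
      have h := dissipation_le_flux hε.le hK.le hN hN0 hM hD hD0 hE hΦ hEN
        (hN.const_mul K) hΦN x₀ n
      rw [intervalIntegral.integral_const_mul, intervalIntegral.integral_const_mul] at h
      have h1 := mul_le_mul_of_nonneg_left (hM (x₀ + n)) hK.le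
      have h2 := mul_le_mul_of_nonneg_left (hMl (x₀ - n)) hK.le
      simp only [ha]
      linarith
    have step : ∀ n : ℕ, a n ≤ 2 * (K * M) / k + K * k * (a (n + 1) - a n)
        + ε * (K * M * (2 * n + 2)) := fun n => by
      have h := dissipation_le_flux (R := fun x => K / k * N x + K * k * D x)
        hε.le hK.le hN hN0 hM hD hD0 hE hΦ hEN (by fun_prop)
        (fun x => (hΦD x (1 / k) (by positivity)).trans_eq (by field_simp)) x₀ n
      have hKk : 0 ≤ K / k := by positivity
      have split : ∀ c d : ℝ, ∫ x in c..d, (K / k * N x + K * k * D x)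
          = K / k * (∫ x in c..d, N x) + K * k * ∫ x in c..d, D x := fun c d => by
        rw [intervalIntegral.integral_add ((hNi c d).const_mul _) ((hDi c d).const_mul _),
          intervalIntegral.integral_const_mul, intervalIntegral.integral_const_mul]
      rw [split, split] at h
      have h1 := mul_le_mul_of_nonneg_left (hM (x₀ + n)) hKk
      have h2 := mul_le_mul_of_nonneg_left (hMl (x₀ - n)) hKk
      rw [succ_eq n]
      have e : 2 * (K * M) / k = K / k * M + K / k * M := by ring
      rw [e]
      simp only [ha]
      linarith
    have hKM : 0 ≤ K * M := by positivity
    have sum : ∀ L : ℕ, L * a 1 ≤ L * (2 * (K * M) / k) + K * k * (a (L + 1) - a 1)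
        + ε * (K * M * (L * (2 * L + 2))) := fun L => by
      induction L with
      | zero => simp
      | succ L ih =>
        have h1 := step (L + 1)
        have h2 : a 1 ≤ a (L + 1) := mono (by omega)
        have hL : (0 : ℝ) ≤ L := L.cast_nonneg
        have h3 : ε * (K * M * (L * (2 * L + 2))) + ε * (K * M * (2 * (L + 1) + 2))
            ≤ ε * (K * M * ((L + 1) * (2 * (L + 1) + 2))) := by
          rw [← mul_add, ← mul_add]
          gcongr
          nlinarith
        push_cast at h1 ⊢
        linarith
    have h1 := sum (k ^ 2)
    have h2 := bdd (k ^ 2 + 1)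
    push_cast at h1 h2
    have h3 : K * k * (a (k ^ 2 + 1) - a 1)
        ≤ K * k * (2 * (K * M) + ε * (K * M * (2 * ((k : ℝ) ^ 2 + 1) + 2))) := by
      gcongr
      linarith [ha0 1]
    have e1 : ε * (2 * ((k : ℝ) ^ 2 + 1) + 2) ≤ 6 := by
      rw [hεdef, one_div, inv_mul_le_iff₀ (by positivity)]
      nlinarith [one_le_pow₀ (n := 2) hk1]
    have e2 : ε * ((k : ℝ) ^ 2 * (2 * (k : ℝ) ^ 2 + 2)) ≤ 4 := by
      rw [hεdef, one_div, inv_mul_le_iff₀ (by positivity)]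
      nlinarith [one_le_pow₀ (n := 2) hk1]
    have h4 : (k : ℝ) ^ 2 * a 1 ≤ k * (6 * (K * M) + 8 * (K * (K * M))) := by
      have f1 : (k : ℝ) ^ 2 * (2 * (K * M) / k) = k * (2 * (K * M)) := by field_simp
      have f2 := mul_le_mul_of_nonneg_left e1 (by positivity : 0 ≤ K * k * (K * M))
      have f3 := mul_le_mul_of_nonneg_left e2 hKM
      have f4 := mul_le_mul_of_nonneg_right hk1 hKM
      rw [f1] at h1
      linarith
    have h5 : k * a 1 ≤ 6 * (K * M) + 8 * (K * (K * M)) := by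
      refine le_of_mul_le_mul_left ?_ hk0
      linarith
    have h6 : ∫ x in (x₀ - 1)..(x₀ + 1), q x ≤ K * a 1 := by
      simp only [ha, Nat.cast_one]
      rw [← intervalIntegral.integral_const_mul]
      exact intervalIntegral.integral_mono_on (by linarith) (hq.intervalIntegrable _ _)
        ((hDi _ _).const_mul K) fun x _ => hqD x
    calc (k : ℝ) * ∫ x in (x₀ - 1)..(x₀ + 1), q x ≤ k * (K * a 1) := by gcongr
      _ = K * (k * a 1) := by ring
      _ ≤ _ := by gcongr
  by_contra hne
  have hpos : 0 < ∫ x in (x₀ - 1)..(x₀ + 1), q x :=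
    intervalIntegral.integral_pos (by linarith) hq.continuousOn (fun x _ => hq0 x)
      ⟨x₀, ⟨by linarith, by linarith⟩, (hq0 x₀).lt_of_ne' hne⟩
  obtain ⟨k, hk⟩ := exists_nat_gt
    (K * (6 * (K * M) + 8 * (K * (K * M))) / ∫ x in (x₀ - 1)..(x₀ + 1), q x)
  rw [div_lt_iff₀ hpos] at hk
  have h1 := key (k + 1) (by omega)
  push_cast at h1
  linarith

end Growth

section PartialDerivatives

variable {f : ℝ → ℝ → ℝ}

lemma hasDerivAt_pdx (hf : ContDiff ℝ (⊤ : ℕ∞) (Function.uncurry f)) (x y : ℝ) :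
    HasDerivAt (fun t => f t y) (pdx f x y) x := by
  have h : DifferentiableAt ℝ (fun t => Function.uncurry f (t, y)) x :=
    (hf.differentiable (by simp)).differentiableAt.comp x (by fun_prop)
  exact h.hasDerivAt

lemma hasDerivAt_pdy (hf : ContDiff ℝ (⊤ : ℕ∞) (Function.uncurry f)) (x y : ℝ) :
    HasDerivAt (fun t => f x t) (pdy f x y) y := by
  have h : DifferentiableAt ℝ (fun t => Function.uncurry f (x, t)) y :=
    (hf.differentiable (by simp)).differentiableAt.comp y (by fun_prop)
  exact h.hasDerivAt

lemma uncurry_pdx (hf : ContDiff ℝ (⊤ : ℕ∞) (Function.uncurry f)) :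
    Function.uncurry (pdx f) = fun p => fderiv ℝ (Function.uncurry f) p (1, 0) := by
  ext ⟨x, y⟩
  have h := ((hf.differentiable (by simp)).differentiableAt (x := (x, y))).hasFDerivAt
  exact (h.comp_hasDerivAt x ((hasDerivAt_id x).prodMk (hasDerivAt_const x y))).deriv

lemma uncurry_pdy (hf : ContDiff ℝ (⊤ : ℕ∞) (Function.uncurry f)) :
    Function.uncurry (pdy f) = fun p => fderiv ℝ (Function.uncurry f) p (0, 1) := by
  ext ⟨x, y⟩
  have h := ((hf.differentiable (by simp)).differentiableAt (x := (x, y))).hasFDerivAt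
  exact (h.comp_hasDerivAt y ((hasDerivAt_const y x).prodMk (hasDerivAt_id y))).deriv

lemma contDiff_pdx (hf : ContDiff ℝ (⊤ : ℕ∞) (Function.uncurry f)) :
    ContDiff ℝ (⊤ : ℕ∞) (Function.uncurry (pdx f)) := by
  rw [uncurry_pdx hf]
  exact (hf.fderiv_right (m := (⊤ : ℕ∞)) (by simp)).clm_apply contDiff_const

lemma contDiff_pdy (hf : ContDiff ℝ (⊤ : ℕ∞) (Function.uncurry f)) :
    ContDiff ℝ (⊤ : ℕ∞) (Function.uncurry (pdy f)) := by
  rw [uncurry_pdy hf]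
  exact (hf.fderiv_right (m := (⊤ : ℕ∞)) (by simp)).clm_apply contDiff_const

lemma pdx_pdy_comm (hf : ContDiff ℝ (⊤ : ℕ∞) (Function.uncurry f)) :
    pdx (pdy f) = pdy (pdx f) := by
  have hd : Differentiable ℝ (fderiv ℝ (Function.uncurry f)) :=
    (hf.fderiv_right (m := (⊤ : ℕ∞)) (by simp)).differentiable (by simp)
  ext x y
  have e1 := congrFun (uncurry_pdx (contDiff_pdy hf)) (x, y)
  have e2 := congrFun (uncurry_pdy (contDiff_pdx hf)) (x, y)
  simp only [Function.uncurry_apply_pair] at e1 e2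
  rw [e1, e2, uncurry_pdx hf, uncurry_pdy hf,
    fderiv_clm_apply (hd _) (differentiableAt_const _),
    fderiv_clm_apply (hd _) (differentiableAt_const _)]
  have hs : IsSymmSndFDerivAt ℝ (Function.uncurry f) (x, y) :=
    hf.contDiffAt.isSymmSndFDerivAt (by
      rw [minSmoothness_of_isRCLikeNormedField]
      exact WithTop.coe_le_coe.2 (le_top (a := (2 : ℕ∞))))
  simpa using hs (1, 0) (0, 1)

end PartialDerivatives

section ParametricIntegral

/-- The reciprocal of `F` on `[-1, 1]`, extended by constants. -/
noncomputable def weight (F : ℝ → ℝ) (y : ℝ) : ℝ := (F (max (-1) (min 1 y)))⁻¹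

lemma continuous_weight {F : ℝ → ℝ} (hF : Continuous F)
    (hpos : ∀ y ∈ Icc (-1 : ℝ) 1, 0 < F y) : Continuous (weight F) := by
  refine Continuous.inv₀ (by fun_prop) fun y => (hpos _ ⟨le_max_left _ _, ?_⟩).ne'
  exact max_le (by norm_num) (min_le_left _ _)

lemma integral_div_eq_integral_mul_weight (F g : ℝ → ℝ) :
    ∫ y in (-1 : ℝ)..1, g y / F y = ∫ y in (-1 : ℝ)..1, g y * weight F y := by
  refine intervalIntegral.integral_congr fun y hy => ?_
  rw [uIcc_of_le (by norm_num)] at hy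
  simp [weight, min_eq_right hy.2, max_eq_right hy.1, div_eq_mul_inv]

lemma continuous_integral_div {F : ℝ → ℝ} (hF : Continuous F)
    (hpos : ∀ y ∈ Icc (-1 : ℝ) 1, 0 < F y) {g : ℝ → ℝ → ℝ}
    (hg : Continuous (Function.uncurry g)) :
    Continuous fun x => ∫ y in (-1 : ℝ)..1, g x y / F y := by
  simp only [integral_div_eq_integral_mul_weight]
  have hw := continuous_weight hF hpos
  refine intervalIntegral.continuous_parametric_intervalIntegral_of_continuous' ?_ _ _
  exact hg.mul (hw.comp continuous_snd)

lemma continuous_slice {k : ℝ → ℝ → ℝ} (hk : Continuous (Function.uncurry k)) (x : ℝ) :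
    Continuous (k x) :=
  hk.comp (Continuous.prodMk_right x)

lemma hasDerivAt_integral_of_continuous {g g' : ℝ → ℝ → ℝ}
    (hg : Continuous (Function.uncurry g)) (hg' : Continuous (Function.uncurry g'))
    (h : ∀ x y, HasDerivAt (fun t => g t y) (g' x y) x) (a b x : ℝ) :
    HasDerivAt (fun x => ∫ y in a..b, g x y) (∫ y in a..b, g' x y) x := by
  obtain ⟨K, hK⟩ := ((isCompact_Icc (a := x - 1) (b := x + 1)).prod
    (isCompact_uIcc (a := a) (b := b))).exists_bound_of_continuousOn hg'.continuousOn
  refine (intervalIntegral.hasDerivAt_integral_of_dominated_loc_of_deriv_le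
    (s := Icc (x - 1) (x + 1)) (bound := fun _ => K)
    (Icc_mem_nhds (by linarith) (by linarith))
    (.of_forall fun x => (continuous_slice hg x).aestronglyMeasurable)
    ((continuous_slice hg x).intervalIntegrable _ _) (continuous_slice hg' x).aestronglyMeasurable
    (.of_forall fun t ht x hx => hK (x, t) ⟨hx, uIoc_subset_uIcc ht⟩)
    intervalIntegrable_const (.of_forall fun t _ x _ => h x t)).2

lemma hasDerivAt_integral_div {F : ℝ → ℝ} (hF : Continuous F)
    (hpos : ∀ y ∈ Icc (-1 : ℝ) 1, 0 < F y) {g g' : ℝ → ℝ → ℝ}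
    (hg : Continuous (Function.uncurry g)) (hg' : Continuous (Function.uncurry g'))
    (h : ∀ x y, HasDerivAt (fun t => g t y) (g' x y) x) (x : ℝ) :
    HasDerivAt (fun x => ∫ y in (-1 : ℝ)..1, g x y / F y)
      (∫ y in (-1 : ℝ)..1, g' x y / F y) x := by
  simp only [integral_div_eq_integral_mul_weight]
  have hw := (continuous_weight hF hpos).comp (continuous_snd (X := ℝ))
  exact hasDerivAt_integral_of_continuous (g := fun x y => g x y * weight F y)
    (g' := fun x y => g' x y * weight F y) (hg.mul hw) (hg'.mul hw)
    (fun x y => (h x y).mul_const _) _ _ x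

end ParametricIntegral

section Energy

/-- Numerator of the energy flux through the cross-section at `x`. -/
noncomputable def fluxDensity (F : ℝ → ℝ) (κ : ℝ) (ψ : ℝ → ℝ → ℝ) (x y : ℝ) : ℝ :=
  (F y * pdy (pdy ψ) x y - κ * ψ x y) * ψ x y / 2 - 2 * pdy (pdy (pdx ψ)) x y * ψ x y
    - pdx (pdx (pdx ψ)) x y * ψ x y + pdx (pdx ψ) x y * pdx ψ x y
    + F y * (ψ x y * pdx (pdx ψ) x y - pdx ψ x y ^ 2 / 2)

/-- Numerator of the dissipation in the cross-section at `x`. -/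
noncomputable def dissipationDensity (ψ : ℝ → ℝ → ℝ) (x y : ℝ) : ℝ :=
  ψ x y * pdy (pdy (pdy (pdy ψ))) x y - 2 * (pdx ψ x y * pdy (pdy (pdx ψ)) x y)
    + pdx (pdx ψ) x y ^ 2

/-- Numerator of the error produced by adding a constant to the base flow. -/
noncomputable def errorDensity (ψ : ℝ → ℝ → ℝ) (x y : ℝ) : ℝ :=
  ψ x y * (pdy (pdy (pdx ψ)) x y + pdx (pdx (pdx ψ)) x y)

variable {ψ : ℝ → ℝ → ℝ}

lemma continuous_dissipationDensity (hψ : ContDiff ℝ (⊤ : ℕ∞) (Function.uncurry ψ)) :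
    Continuous (Function.uncurry (dissipationDensity ψ)) := by
  have h0 := hψ.continuous
  have h1 := (contDiff_pdy (contDiff_pdy (contDiff_pdy (contDiff_pdy hψ)))).continuous
  have h2 := (contDiff_pdx hψ).continuous
  have h3 := (contDiff_pdy (contDiff_pdy (contDiff_pdx hψ))).continuous
  have h4 := (contDiff_pdx (contDiff_pdx hψ)).continuous
  exact ((h0.mul h1).sub ((h2.mul h3).const_mul 2)).add (h4.pow 2)

lemma continuous_errorDensity (hψ : ContDiff ℝ (⊤ : ℕ∞) (Function.uncurry ψ)) :
    Continuous (Function.uncurry (errorDensity ψ)) := by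
  have h0 := hψ.continuous
  have h1 := (contDiff_pdy (contDiff_pdy (contDiff_pdx hψ))).continuous
  have h2 := (contDiff_pdx (contDiff_pdx (contDiff_pdx hψ))).continuous
  exact h0.mul (h1.add h2)

lemma integral_wronskian_eq_zero {u u' u'' v v' v'' : ℝ → ℝ} {a b : ℝ}
    (hu : ∀ y, HasDerivAt u (u' y) y) (hu' : ∀ y, HasDerivAt u' (u'' y) y)
    (hv : ∀ y, HasDerivAt v (v' y) y) (hv' : ∀ y, HasDerivAt v' (v'' y) y)
    (hu'' : Continuous u'') (hv'' : Continuous v'')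
    (hua : u a = 0) (hub : u b = 0) (hva : v a = 0) (hvb : v b = 0) :
    ∫ y in a..b, (u'' y * v y - v'' y * u y) = 0 := by
  have cu : Continuous u := continuous_iff_continuousAt.2 fun y => (hu y).continuousAt
  have cv : Continuous v := continuous_iff_continuousAt.2 fun y => (hv y).continuousAt
  rw [integral_eq_sub_of_hasDerivAt (f := fun y => u' y * v y - v' y * u y)
    (fun y _ => (((hu' y).mul (hv y)).sub ((hv' y).mul (hu y))).congr_deriv (by ring))
    (Continuous.intervalIntegrable (by fun_prop) _ _)]
  simp [hua, hub, hva, hvb]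

lemma hasDerivAt_flux {F : ℝ → ℝ} {κ ε : ℝ} (hF : Continuous F)
    (hpos : ∀ y ∈ Icc (-1 : ℝ) 1, 0 < F y)
    (hψ : ContDiff ℝ (⊤ : ℕ∞) (Function.uncurry ψ))
    (heq : ∀ x : ℝ, ∀ y ∈ Ioo (-1 : ℝ) 1,
      pdx (pdx (pdx (pdx ψ))) x y + 2 * pdy (pdy (pdx (pdx ψ))) x y
          + pdy (pdy (pdy (pdy ψ))) x y
        - ((F y - ε) * (pdy (pdy (pdx ψ)) x y + pdx (pdx (pdx ψ)) x y)
            - κ * pdx ψ x y) = 0)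
    (hbc : ∀ x, ψ x (-1) = 0 ∧ ψ x 1 = 0 ∧ pdx ψ x (-1) = 0 ∧ pdx ψ x 1 = 0) (x : ℝ) :
    HasDerivAt (fun x => ∫ y in (-1 : ℝ)..1, fluxDensity F κ ψ x y / F y)
      ((∫ y in (-1 : ℝ)..1, dissipationDensity ψ x y / F y)
        + ε * ∫ y in (-1 : ℝ)..1, errorDensity ψ x y / F y) x := by
  have s1 := contDiff_pdx hψ
  have s2 := contDiff_pdx s1
  have s3 := contDiff_pdx s2
  have s4 := contDiff_pdx s3
  have t0 := contDiff_pdy (contDiff_pdy hψ)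
  have t1 := contDiff_pdy (contDiff_pdy s1)
  have t2 := contDiff_pdy (contDiff_pdy s2)
  have t4 := contDiff_pdy (contDiff_pdy t0)
  have c0 := hψ.continuous
  have c1 := s1.continuous
  have c2 := s2.continuous
  have c3 := s3.continuous
  have c4 := s4.continuous
  have d0 := t0.continuous
  have d1 := t1.continuous
  have d2 := t2.continuous
  have d4 := t4.continuous
  have e0 : pdx (pdy (pdy ψ)) = pdy (pdy (pdx ψ)) := by
    rw [pdx_pdy_comm (contDiff_pdy hψ), pdx_pdy_comm hψ]
  have e1 : pdx (pdy (pdy (pdx ψ))) = pdy (pdy (pdx (pdx ψ))) := by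
    rw [pdx_pdy_comm (contDiff_pdy s1), pdx_pdy_comm s1]
  have cF : Continuous fun p : ℝ × ℝ => F p.2 := hF.comp continuous_snd
  have hsl : ∀ {k : ℝ → ℝ → ℝ}, Continuous (Function.uncurry k) → Continuous (k x) :=
    fun hk => continuous_slice hk x
  have heq' : ∀ y ∈ Icc (-1 : ℝ) 1,
      pdx (pdx (pdx (pdx ψ))) x y + 2 * pdy (pdy (pdx (pdx ψ))) x y
          + pdy (pdy (pdy (pdy ψ))) x y
        - ((F y - ε) * (pdy (pdy (pdx ψ)) x y + pdx (pdx (pdx ψ)) x y)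
            - κ * pdx ψ x y) = 0 := by
    have h4 := hsl c4
    have k2 := hsl d2
    have k4 := hsl d4
    have k1 := hsl d1
    have h3 := hsl c3
    have h1 := hsl c1
    rw [← closure_Ioo (by norm_num : (-1 : ℝ) ≠ 1)]
    refine closure_minimal (fun y hy => heq x y hy) (isClosed_eq ?_ continuous_const)
    fun_prop
  let g' : ℝ → ℝ → ℝ := fun x y =>
    ((F y * pdy (pdy (pdx ψ)) x y - κ * pdx ψ x y) * ψ x y
      + (F y * pdy (pdy ψ) x y - κ * ψ x y) * pdx ψ x y) / 2
    - 2 * (pdy (pdy (pdx (pdx ψ))) x y * ψ x y + pdy (pdy (pdx ψ)) x y * pdx ψ x y)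
    - pdx (pdx (pdx (pdx ψ))) x y * ψ x y + pdx (pdx ψ) x y ^ 2
    + F y * (ψ x y * pdx (pdx (pdx ψ)) x y)
  have cg : Continuous (Function.uncurry (fluxDensity F κ ψ)) :=
    (((((((cF.mul d0).sub (c0.const_mul κ)).mul c0).div_const 2).sub
      ((d1.const_mul 2).mul c0)).sub (c3.mul c0)).add (c2.mul c1)).add
      (cF.mul ((c0.mul c2).sub ((c1.pow 2).div_const 2)))
  have cg' : Continuous (Function.uncurry g') :=
    (((((((cF.mul d1).sub (c1.const_mul κ)).mul c0).add
      (((cF.mul d0).sub (c0.const_mul κ)).mul c1)).div_const 2).sub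
      (((d2.mul c0).add (d1.mul c1)).const_mul 2)).sub (c4.mul c0)).add (c2.pow 2) |>.add
      (cF.mul (c0.mul c3))
  have hd : ∀ x y, HasDerivAt (fun t => fluxDensity F κ ψ t y) (g' x y) x := fun x y => by
    have a0 := hasDerivAt_pdx hψ x y
    have a1 := hasDerivAt_pdx s1 x y
    have a2 := hasDerivAt_pdx s2 x y
    have a3 := hasDerivAt_pdx s3 x y
    have b0 := hasDerivAt_pdx t0 x y
    have b1 := hasDerivAt_pdx t1 x y
    rw [e0] at b0
    rw [e1] at b1
    refine ((((((((b0.const_mul (F y)).sub (a0.const_mul κ)).mul a0).div_const 2).sub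
      ((b1.const_mul 2).mul a0)).sub (a3.mul a0)).add (a2.mul a1)).add
      (((a0.mul a2).sub ((a1.pow 2).div_const 2)).const_mul (F y))).congr_deriv ?_
    simp only [g', Pi.sub_apply]
    push_cast
    ring
  refine (hasDerivAt_integral_div hF hpos cg cg' hd x).congr_deriv ?_
  have hint : ∀ {k : ℝ → ℝ}, Continuous k →
      IntervalIntegrable (fun y => k y / F y) volume (-1) 1 := fun hk => by
    refine ContinuousOn.intervalIntegrable (hk.continuousOn.div hF.continuousOn fun y hy => ?_)
    rw [uIcc_of_le (by norm_num)] at hy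
    exact (hpos y hy).ne'
  have hw := integral_wronskian_eq_zero (fun y => hasDerivAt_pdy hψ x y)
    (fun y => hasDerivAt_pdy (contDiff_pdy hψ) x y) (fun y => hasDerivAt_pdy s1 x y)
    (fun y => hasDerivAt_pdy (contDiff_pdy s1) x y) (hsl d0) (hsl d1)
    (hbc x).1 (hbc x).2.1 (hbc x).2.2.1 (hbc x).2.2.2
  have iD := hint (hsl (continuous_dissipationDensity hψ))
  have iE := hint (hsl (continuous_errorDensity hψ))
  have iW : IntervalIntegrable (fun y => pdy (pdy ψ) x y * pdx ψ x y
      - pdy (pdy (pdx ψ)) x y * ψ x y) volume (-1) 1 :=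
    (((hsl d0).mul (hsl c1)).sub ((hsl d1).mul (hsl c0))).intervalIntegrable _ _
  have split : ∫ y in (-1 : ℝ)..1, g' x y / F y
      = ∫ y in (-1 : ℝ)..1, ((dissipationDensity ψ x y / F y + ε * (errorDensity ψ x y / F y))
        + 1 / 2 * (pdy (pdy ψ) x y * pdx ψ x y - pdy (pdy (pdx ψ)) x y * ψ x y)) := by
    refine intervalIntegral.integral_congr fun y hy => ?_
    rw [uIcc_of_le (by norm_num)] at hy
    have hy' := heq' y hy
    have hne := (hpos y hy).ne'
    simp only [g', dissipationDensity, errorDensity]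
    field_simp
    linear_combination (-2 * ψ x y) * hy'
  rw [split, intervalIntegral.integral_add (iD.add (iE.const_mul ε)) (iW.const_mul _),
    intervalIntegral.integral_add iD (iE.const_mul ε), intervalIntegral.integral_const_mul,
    intervalIntegral.integral_const_mul, hw, mul_zero, add_zero]

end Energy

lemma exists_mul_le_baseFlow {A B C : ℝ} (hABC : (A, B, C) ≠ (0, 0, 0)) (hA : A ≤ 0)
    (hB : |B| ≤ 3 * A + C) :
    ∃ c : ℝ, 0 < c ∧ c ≤ 1 ∧
      ∀ y ∈ Icc (-1 : ℝ) 1, c * (1 - y ^ 2) ≤ 3 * A * y ^ 2 + B * y + C := by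
  have hAC : 0 ≤ 3 * A + C := (abs_nonneg B).trans hB
  have hc0 : 0 < -3 * A + (3 * A + C) / 2 := by
    by_contra h
    have h1 : A = 0 := by linarith
    have h2 : C = 0 := by linarith
    subst h1 h2
    have h3 : B = 0 := abs_nonpos_iff.1 (by simpa using hB)
    exact hABC (by rw [h3])
  refine ⟨min (-3 * A + (3 * A + C) / 2) 1, lt_min hc0 one_pos, min_le_right _ _,
    fun y hy => ?_⟩
  have hy1 : |y| ≤ 1 := abs_le.2 hy
  have hy2 : 0 ≤ 1 - y ^ 2 := by nlinarith [hy.1, hy.2]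
  have h1 : -(B * y) ≤ (3 * A + C) * |y| := (neg_le_abs _).trans (by
    rw [abs_mul]
    exact mul_le_mul_of_nonneg_right hB (abs_nonneg y))
  have h2 : (3 * A + C) * ((1 - y ^ 2) / 2) ≤ (3 * A + C) * (1 - |y|) :=
    mul_le_mul_of_nonneg_left (by nlinarith [sq_abs y, sq_nonneg (1 - |y|)]) hAC
  have h3 := mul_le_mul_of_nonneg_right (min_le_left (-3 * A + (3 * A + C) / 2) 1) hy2
  linarith

/-- Sum of the squares of all partial derivatives of order between 1 and 3. -/
noncomputable def derivSqSum (ψ : ℝ → ℝ → ℝ) (x y : ℝ) : ℝ :=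
  (pdx ψ x y) ^ 2 + (pdy ψ x y) ^ 2
    + (pdx (pdx ψ) x y) ^ 2 + (pdy (pdx ψ) x y) ^ 2 + (pdy (pdy ψ) x y) ^ 2
    + (pdx (pdx (pdx ψ)) x y) ^ 2 + (pdy (pdx (pdx ψ)) x y) ^ 2
    + (pdy (pdy (pdx ψ)) x y) ^ 2 + (pdy (pdy (pdy ψ)) x y) ^ 2

lemma continuous_derivSqSum {ψ : ℝ → ℝ → ℝ} (s0 : ContDiff ℝ (⊤ : ℕ∞) (Function.uncurry ψ)) :
    Continuous (Function.uncurry (derivSqSum ψ)) := by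
  have s1 := contDiff_pdx s0
  have s2 := contDiff_pdx s1
  have s3 := contDiff_pdx s2
  have u1 := contDiff_pdy s0
  have u2 := contDiff_pdy u1
  have u3 := contDiff_pdy u2
  have v1 := contDiff_pdy s1
  have v2 := contDiff_pdy v1
  exact ((((((((s1.continuous.pow 2).add (u1.continuous.pow 2)).add (s2.continuous.pow 2)).add
    (v1.continuous.pow 2)).add (u2.continuous.pow 2)).add (s3.continuous.pow 2)).add
    ((contDiff_pdy s2).continuous.pow 2)).add (v2.continuous.pow 2)).add
    (u3.continuous.pow 2)

lemma exists_flux_bounds {A B C m c ε : ℝ} {ψ : ℝ → ℝ → ℝ} (hA : A ≤ 0)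
    (s0 : ContDiff ℝ (⊤ : ℕ∞) (Function.uncurry ψ))
    (heq : ∀ x : ℝ, ∀ y ∈ Ioo (-1 : ℝ) 1,
      pdx (pdx (pdx (pdx ψ))) x y + 2 * pdy (pdy (pdx (pdx ψ))) x y
          + pdy (pdy (pdy (pdy ψ))) x y
        - ((3 * A * y ^ 2 + B * y + C) * (pdy (pdy (pdx ψ)) x y + pdx (pdx (pdx ψ)) x y)
            - 6 * A * pdx ψ x y) = 0)
    (hbc : ∀ x : ℝ, ψ x (-1) = 0 ∧ ψ x 1 = 0 ∧ pdx ψ x (-1) = 0 ∧ pdx ψ x 1 = 0 ∧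
      pdy ψ x (-1) = 0 ∧ pdy ψ x 1 = 0)
    (hm : m = 1 + 6 * |A| + |B| + |C|) (hc : 0 < c) (hc1 : c ≤ 1)
    (hFc : ∀ y ∈ Icc (-1 : ℝ) 1, c * (1 - y ^ 2) ≤ 3 * A * y ^ 2 + B * y + C)
    (hε : 0 < ε) (hε1 : ε ≤ 1) :
    ∃ Φ D E : ℝ → ℝ, Continuous D ∧ Continuous E ∧ (∀ x, HasDerivAt Φ (D x + ε * E x) x) ∧
      (∀ x, |Φ x| ≤ 100 * m ^ 2 * (1 / c) ^ 3 * ∫ y in (-1 : ℝ)..1, derivSqSum ψ x y) ∧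
      (∀ x s, 0 < s → |Φ x| ≤ 100 * m ^ 2 * (1 / c) ^ 3 *
        (s * (∫ y in (-1 : ℝ)..1, derivSqSum ψ x y) + 1 / s * D x)) ∧
      (∀ x, |E x| ≤ 100 * m ^ 2 * (1 / c) ^ 3 * ∫ y in (-1 : ℝ)..1, derivSqSum ψ x y) ∧
      ∀ x, ∫ y in (-1 : ℝ)..1, ψ x y ^ 2 ≤ 100 * m ^ 2 * (1 / c) ^ 3 * D x := by
  have hm1 : 1 ≤ m := by
    have := abs_nonneg A
    have := abs_nonneg B
    have := abs_nonneg C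
    linarith
  have hκ : (6 * A) ^ 2 ≤ m ^ 2 := by
    rw [sq_le_sq, abs_mul, Nat.abs_ofNat, abs_of_pos (a := m) (by linarith)]
    linarith [abs_nonneg B, abs_nonneg C]
  have s1 := contDiff_pdx s0
  have s2 := contDiff_pdx s1
  have s3 := contDiff_pdx s2
  have u1 := contDiff_pdy s0
  have u2 := contDiff_pdy u1
  have u3 := contDiff_pdy u2
  have u4 := contDiff_pdy u3
  have v1 := contDiff_pdy s1
  have v2 := contDiff_pdy v1
  have hv : ∀ x, pdy (pdx ψ) x (-1) = 0 ∧ pdy (pdx ψ) x 1 = 0 := fun x => by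
    rw [← pdx_pdy_comm s0]
    simp [pdx, fun t => (hbc t).2.2.2.2.1, fun t => (hbc t).2.2.2.2.2]
  obtain ⟨F, hF⟩ : ∃ F : ℝ → ℝ, ∀ y, F y = 3 * A * y ^ 2 + B * y + C + ε := ⟨_, fun _ => rfl⟩
  have cF : Continuous F := by
    rw [funext hF]
    fun_prop
  have hpos : ∀ y ∈ Icc (-1 : ℝ) 1, 0 < F y := fun y hy => by
    have h1 := hFc y hy
    have h2 : 0 ≤ c * (1 - y ^ 2) := mul_nonneg hc.le (by nlinarith [hy.1, hy.2])
    rw [hF]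
    linarith
  have hFd : ∀ y, HasDerivAt F (6 * A * y + B) y := fun y => by
    have h := ((((hasDerivAt_id y).pow 2).const_mul (3 * A)).add
      ((hasDerivAt_id y).const_mul B)).add_const C |>.add_const ε
    rw [funext hF]
    refine h.congr_deriv ?_
    simp only [id]
    push_cast
    ring
  have hFd' : ∀ y, HasDerivAt (fun y => 6 * A * y + B) (6 * A) y := fun y =>
    (((hasDerivAt_id y).const_mul (6 * A)).add_const B).congr_deriv (by ring)
  have hFc' : ∀ y ∈ Icc (-1 : ℝ) 1, c * (1 - y ^ 2) ≤ F y := fun y hy => by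
    have h1 := hFc y hy
    rw [hF]
    linarith
  have hFm : ∀ y ∈ Icc (-1 : ℝ) 1, F y ≤ m := fun y hy => by
    have h1 : B * y ≤ |B| := (le_abs_self _).trans (by
      rw [abs_mul]
      exact mul_le_of_le_one_right (abs_nonneg B) (abs_le.2 hy))
    have h2 : 3 * A * y ^ 2 ≤ 0 := mul_nonpos_of_nonpos_of_nonneg (by linarith) (sq_nonneg y)
    rw [hF]
    linarith [le_abs_self C, abs_nonneg A]
  have d0 : ∀ x y, HasDerivAt (ψ x) (pdy ψ x y) y := hasDerivAt_pdy s0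
  have d1 : ∀ x y, HasDerivAt (pdy ψ x) (pdy (pdy ψ) x y) y := hasDerivAt_pdy u1
  have d2 : ∀ x y, HasDerivAt (pdy (pdy ψ) x) (pdy (pdy (pdy ψ)) x y) y := hasDerivAt_pdy u2
  have d3 : ∀ x y, HasDerivAt (pdy (pdy (pdy ψ)) x) (pdy (pdy (pdy (pdy ψ))) x y) y :=
    hasDerivAt_pdy u3
  have e0 : ∀ x y, HasDerivAt (pdx ψ x) (pdy (pdx ψ) x y) y := hasDerivAt_pdy s1
  have e1 : ∀ x y, HasDerivAt (pdy (pdx ψ) x) (pdy (pdy (pdx ψ)) x y) y := hasDerivAt_pdy v1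
  have c4 := continuous_slice u4.continuous
  have c5 := continuous_slice v2.continuous
  have c2 := continuous_slice s2.continuous
  have c3 := continuous_slice s3.continuous
  have cS : ∀ x, Continuous (derivSqSum ψ x) := fun x =>
    continuous_slice (continuous_derivSqSum s0) x
  have est := fun x => cross_section_estimates (F := F) (F' := fun y => 6 * A * y + B)
    (p₀ := ψ x) (q₁ := pdy ψ x) (q₂ := pdy (pdy ψ) x) (q₃ := pdy (pdy (pdy ψ)) x)
    (q₄ := pdy (pdy (pdy (pdy ψ))) x) (p₁ := pdx ψ x) (r₁ := pdy (pdx ψ) x)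
    (r₂ := pdy (pdy (pdx ψ)) x) (p₂ := pdx (pdx ψ) x) (p₃ := pdx (pdx (pdx ψ)) x)
    (S := derivSqSum ψ x) (c := c) (m := m) (κ := 6 * A)
    (N := ∫ y in (-1 : ℝ)..1, derivSqSum ψ x y) (K := 100 * m ^ 2 * (1 / c) ^ 3)
    (Φ := ∫ y in (-1 : ℝ)..1, fluxDensity F (6 * A) ψ x y / F y)
    (D := ∫ y in (-1 : ℝ)..1, dissipationDensity ψ x y / F y)
    (E := ∫ y in (-1 : ℝ)..1, errorDensity ψ x y / F y) hc hc1 hm1 (by linarith)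
    hκ hFd hFd' hpos hFc' hFm
    (d0 x) (d1 x) (d2 x) (d3 x) (c4 x) (e0 x) (e1 x) (c5 x) (c2 x) (c3 x) (cS x)
    (fun y => by
      simp only [derivSqSum]
      linarith [sq_nonneg (pdy ψ x y), sq_nonneg (pdy (pdx ψ) x y),
        sq_nonneg (pdy (pdx (pdx ψ)) x y), sq_nonneg (pdy (pdy (pdy ψ)) x y)])
    (hbc x).1 (hbc x).2.1 (hbc x).2.2.2.2.1 (hbc x).2.2.2.2.2
    (hbc x).2.2.1 (hbc x).2.2.2.1 (hv x).1 (hv x).2 rfl rfl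
    (by simp only [fluxDensity]) (by simp only [dissipationDensity]) (by simp only [errorDensity])
  exact ⟨fun x => ∫ y in (-1 : ℝ)..1, fluxDensity F (6 * A) ψ x y / F y,
    fun x => ∫ y in (-1 : ℝ)..1, dissipationDensity ψ x y / F y,
    fun x => ∫ y in (-1 : ℝ)..1, errorDensity ψ x y / F y,
    continuous_integral_div cF hpos (continuous_dissipationDensity s0),
    continuous_integral_div cF hpos (continuous_errorDensity s0),
    hasDerivAt_flux cF hpos s0 (fun x y hy => by
      simp only [hF, add_sub_cancel_right]
      exact heq x y hy)
      (fun x => ⟨(hbc x).1, (hbc x).2.1, (hbc x).2.2.1, (hbc x).2.2.2.1⟩),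
    fun x => (est x).1, fun x => (est x).2.1, fun x => (est x).2.2.1,
    fun x => (est x).2.2.2⟩

/-- Injectivity of the Couette–Poiseuille linearization in the locally `L²`
(Ladyzhenskaya–Solonnikov) setting, stream-function form: under condition (ABC), if `ψ` is
smooth, the integrals over the unit slices `(a, a+1) × (-1,1)` of the sum of squares of all
partial derivatives of `ψ` of order between 1 and 3 are bounded by a constant `M` uniformly
in `a`, `ψ` solves the linearized stream-function equation in `S = ℝ × (-1,1)`, and
`ψ = ψ_x = ψ_y = 0` on `y = ±1`, then `ψ ≡ 0`. -/
theorem stmt_13 (A B C : ℝ) (hABC : (A, B, C) ≠ (0, 0, 0)) (hA : A ≤ 0)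
    (hB : |B| ≤ 3 * A + C) (ψ : ℝ → ℝ → ℝ)
    (hsmooth : ContDiff ℝ (⊤ : ℕ∞) (Function.uncurry ψ))
    (M : ℝ) (hM : 0 < M)
    (hloc : ∀ a : ℝ,
      (∫ x in a..(a + 1), ∫ y in (-1 : ℝ)..1,
          ((pdx ψ x y) ^ 2 + (pdy ψ x y) ^ 2
            + (pdx (pdx ψ) x y) ^ 2 + (pdy (pdx ψ) x y) ^ 2 + (pdy (pdy ψ) x y) ^ 2
            + (pdx (pdx (pdx ψ)) x y) ^ 2 + (pdy (pdx (pdx ψ)) x y) ^ 2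
            + (pdy (pdy (pdx ψ)) x y) ^ 2 + (pdy (pdy (pdy ψ)) x y) ^ 2)) ≤ M)
    (heq : ∀ x : ℝ, ∀ y ∈ Set.Ioo (-1 : ℝ) 1,
      pdx (pdx (pdx (pdx ψ))) x y + 2 * pdy (pdy (pdx (pdx ψ))) x y
          + pdy (pdy (pdy (pdy ψ))) x y
        - ((3 * A * y ^ 2 + B * y + C) * (pdy (pdy (pdx ψ)) x y + pdx (pdx (pdx ψ)) x y)
            - 6 * A * pdx ψ x y) = 0)
    (hbc : ∀ x : ℝ, ψ x (-1) = 0 ∧ ψ x 1 = 0 ∧ pdx ψ x (-1) = 0 ∧ pdx ψ x 1 = 0 ∧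
      pdy ψ x (-1) = 0 ∧ pdy ψ x 1 = 0) :
    ∀ x : ℝ, ∀ y ∈ Set.Icc (-1 : ℝ) 1, ψ x y = 0 := by
  obtain ⟨c, hc, hc1, hFc⟩ := exists_mul_le_baseFlow hABC hA hB
  have hq := eq_zero_of_flux_bounds (N := fun x => ∫ y in (-1 : ℝ)..1, derivSqSum ψ x y)
    (q := fun x => ∫ y in (-1 : ℝ)..1, ψ x y ^ 2)
    (K := 100 * (1 + 6 * |A| + |B| + |C|) ^ 2 * (1 / c) ^ 3) (M := M)
    (by positivity) hM.le
    (intervalIntegral.continuous_parametric_intervalIntegral_of_continuous'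
      (continuous_derivSqSum hsmooth) _ _)
    (fun x => intervalIntegral.integral_nonneg (by norm_num) fun y _ => by
      simp only [derivSqSum]
      positivity)
    hloc
    (intervalIntegral.continuous_parametric_intervalIntegral_of_continuous'
      (hsmooth.continuous.pow 2) _ _)
    (fun x => intervalIntegral.integral_nonneg (by norm_num) fun y _ => sq_nonneg _)
    (fun ε hε hε1 => exists_flux_bounds hA hsmooth heq hbc rfl hc hc1 hFc hε hε1)
  intro x y hy
  by_contra hne
  exact (intervalIntegral.integral_pos (by norm_num)
    ((continuous_slice hsmooth.continuous x).pow 2).continuousOn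
    (fun y _ => sq_nonneg _) ⟨y, hy, sq_pos_of_ne_zero hne⟩).ne' (hq x)
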